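/- arXiv:2604.12173 — 8 statements merged into one kernel-verified Lean document; each statement's English description precedes it below -/
import Mathlib

section
/- Let f(z,w) = (p(z), q(z,w)) be a regular polynomial skew product of ℂ² of degree d ≥ 2 such that the one-variable polynomial p is special. Suppose there exist infinitely many p-periodic points z₀, of exact period n = n(z₀), such that the return map Q_{z₀}ⁿ (a one-variable polynomial of degree dⁿ) is special. Then f is a special skew product. -/
open Polynomial

noncomputable section

def ChebT (d : ℕ) : Polynomial ℂ := dickson 1 1 d

def AffConj (f g : Polynomial ℂ) : Prop :=
  ∃ u v : ℂ, u ≠ 0 ∧ f = (C u⁻¹ * (X - C v)).comp (g.comp (C u * X + C v))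

def SpecialPoly (d : ℕ) (f : Polynomial ℂ) : Prop :=
  AffConj f (X ^ d) ∨ AffConj f (ChebT d) ∨ AffConj f (-ChebT d)

def fiber (q : Polynomial (Polynomial ℂ)) (z : ℂ) : Polynomial ℂ :=
  q.map (evalRingHom z)

def IsRegularSkew (d : ℕ) (p : Polynomial ℂ) (q : Polynomial (Polynomial ℂ)) : Prop :=
  p.natDegree = d ∧ (∀ k, q.coeff k ≠ 0 → (q.coeff k).natDegree + k ≤ d) ∧ q.coeff d ≠ 0

def polyIter (p : Polynomial ℂ) : ℕ → Polynomial ℂ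
  | 0 => X
  | n + 1 => (polyIter p n).comp p

def QIter (p : Polynomial ℂ) (q : Polynomial (Polynomial ℂ)) : ℕ → ℂ → Polynomial ℂ
  | 0, _ => X
  | n + 1, z => (QIter p q n (p.eval z)).comp (fiber q z)

def skewMap (p : Polynomial ℂ) (q : Polynomial (Polynomial ℂ)) : ℂ × ℂ → ℂ × ℂ :=
  fun zw => (p.eval zw.1, (fiber q zw.1).eval zw.2)

def TriangConj (f g : ℂ × ℂ → ℂ × ℂ) : Prop :=
  ∃ α β γ δ ε : ℂ, α ≠ 0 ∧ γ ≠ 0 ∧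
    ∀ zw : ℂ × ℂ,
      (α * (g zw).1 + β, ε * (g zw).1 + γ * (g zw).2 + δ)
        = f (α * zw.1 + β, ε * zw.1 + γ * zw.2 + δ)

def SpecialSkew (d : ℕ) (f : ℂ × ℂ → ℂ × ℂ) : Prop :=
  (∃ P Q : Polynomial ℂ,
      (P = X ^ d ∨ P = ChebT d ∨ P = -ChebT d) ∧
      (Q = X ^ d ∨ Q = ChebT d ∨ Q = -ChebT d) ∧
      TriangConj f fun zw => (P.eval zw.1, Q.eval zw.2))
  ∨ (∃ ζ : ℂ, ∃ m : ℕ, ζ ^ (d - 1) = 1 ∧ (m = 1 ∨ m = 2) ∧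
      TriangConj f fun zw => (zw.1 ^ d, (dickson 1 (ζ * zw.1 ^ m) d).eval zw.2))

theorem dickson_one_eval_add (x y : ℂ) (n : ℕ) :
    (dickson 1 (x * y) n).eval (x + y) = x ^ n + y ^ n := by
  induction n using Nat.twoStepInduction with
  | zero => norm_num [dickson_zero]
  | one => simp
  | more n h₁ h₂ =>
    rw [dickson_add_two]
    simp only [eval_sub, eval_mul, eval_X, eval_C, h₁, h₂]
    ring

theorem exists_add_eq_mul_eq (w a : ℂ) : ∃ x y : ℂ, x + y = w ∧ x * y = a := by
  obtain ⟨s, hs⟩ := IsAlgClosed.exists_pow_nat_eq (w ^ 2 - 4 * a) (n := 2) (by norm_num)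
  refine ⟨(w + s) / 2, (w - s) / 2, by ring, ?_⟩
  linear_combination (-1 / 4) * hs

theorem dickson_one_mul (a : ℂ) (m n : ℕ) :
    dickson 1 a (m * n) = (dickson 1 (a ^ n) m).comp (dickson 1 a n) := by
  refine Polynomial.funext fun w => ?_
  obtain ⟨x, y, rfl, rfl⟩ := exists_add_eq_mul_eq w a
  rw [eval_comp, dickson_one_eval_add, dickson_one_eval_add, mul_pow, dickson_one_eval_add]
  ring

theorem dickson_one_eval_smul (μ a w : ℂ) (n : ℕ) :
    (dickson 1 (μ ^ 2 * a) n).eval (μ * w) = μ ^ n * (dickson 1 a n).eval w := by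
  obtain ⟨x, y, rfl, rfl⟩ := exists_add_eq_mul_eq w a
  have h := dickson_one_eval_add (μ * x) (μ * y) n
  rw [show μ * x * (μ * y) = μ ^ 2 * (x * y) by ring, ← mul_add] at h
  rw [h, dickson_one_eval_add]
  ring

theorem dickson_one_zero_right (n : ℕ) (hn : n ≠ 0) : dickson 1 (0 : ℂ) n = X ^ n := by
  refine Polynomial.funext fun w => ?_
  have := dickson_one_eval_add w 0 n
  simpa [hn] using this

/-- `f` is monic of degree `m` and its coefficient of degree `m - 1` vanishes. -/
def MonicCentered (m : ℕ) (f : ℂ[X]) : Prop :=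
  (f - X ^ m).degree < ((m - 1 : ℕ) : WithBot ℕ)

theorem monicCentered_iff {m : ℕ} {f : ℂ[X]} :
    MonicCentered m f ↔ ∀ k, m ≤ k + 1 → f.coeff k = (X ^ m : ℂ[X]).coeff k := by
  rw [MonicCentered, degree_lt_iff_coeff_zero]
  refine forall_congr' fun k => ?_
  rw [coeff_sub, sub_eq_zero, Nat.sub_le_iff_le_add]

theorem monicCentered_dickson (a : ℂ) (n : ℕ) :
    MonicCentered (n + 1) (dickson 1 a (n + 1)) := by
  induction n using Nat.twoStepInduction with
  | zero => simp [MonicCentered]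
  | one =>
    refine monicCentered_iff.2 fun k hk => ?_
    obtain ⟨j, rfl⟩ : ∃ j, k = j + 1 := ⟨k - 1, by omega⟩
    have h : (3 - (1 : ℕ) : ℂ[X]) = C 2 := by norm_num; rfl
    rw [dickson_two, h, ← C_mul, coeff_sub, coeff_C_succ, sub_zero]
  | more n h₁ h₂ =>
    refine monicCentered_iff.2 fun k hk => ?_
    obtain ⟨j, rfl⟩ : ∃ j, k = j + 1 := ⟨k - 1, by omega⟩
    rw [dickson_add_two, coeff_sub, coeff_X_mul, coeff_C_mul,
      monicCentered_iff.1 h₂ j (by omega), monicCentered_iff.1 h₁ (j + 1) (by omega)]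
    simp only [coeff_X_pow]
    rw [if_neg (show ¬ (j + 1 = n + 1) by omega)]
    simp

theorem coeff_dickson_one (a : ℂ) (n : ℕ) :
    (dickson 1 a (n + 2)).coeff n = -(n + 2) * a := by
  induction n with
  | zero =>
    have h : (3 - (1 : ℕ) : ℂ[X]) = C 2 := by norm_num; rfl
    rw [zero_add, dickson_two, h, ← C_mul]
    simp [mul_comm]
  | succ n ih =>
    rw [dickson_add_two, coeff_sub, coeff_X_mul, ih, coeff_C_mul,
      monicCentered_iff.1 (monicCentered_dickson a n) (n + 1) (by omega)]
    simp
    ring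

namespace MonicCentered

variable {m k : ℕ} {f f' g g' : ℂ[X]}

theorem degree_sub_lt (hf : MonicCentered m f) : (f - X ^ m).degree < (m : WithBot ℕ) :=
  lt_of_lt_of_le hf (by exact_mod_cast Nat.sub_le m 1)

theorem monic (hf : MonicCentered m f) : f.Monic := by
  simpa using monic_X_pow_add hf.degree_sub_lt

theorem natDegree_eq (hf : MonicCentered m f) : f.natDegree = m := by
  have h := degree_add_eq_left_of_degree_lt (p := (X ^ m : ℂ[X])) (q := f - X ^ m)
    (by simpa using hf.degree_sub_lt)
  rw [add_sub_cancel, degree_X_pow] at h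
  exact natDegree_eq_of_degree_eq_some h

theorem degree_comp_lt {r : ℂ[X]} (hr : r.degree < (m : WithBot ℕ)) (hk : 0 < k)
    (hg : g.natDegree = k) : (r.comp g).degree < ((m * k : ℕ) : WithBot ℕ) := by
  have hg' : 0 < g.degree := natDegree_pos_iff_degree_pos.1 (hg ▸ hk)
  by_cases h0 : r = 0
  · rw [h0, zero_comp, degree_zero]
    exact WithBot.bot_lt_coe _
  refine degree_le_natDegree.trans_lt (Nat.cast_lt.2 ?_)
  rw [natDegree_comp, hg]
  exact Nat.mul_lt_mul_of_pos_right ((natDegree_lt_iff_degree_lt h0).2 hr) hk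

theorem comp (hm : 0 < m) (hk : 0 < k) (hf : MonicCentered m f) (hg : MonicCentered k g) :
    MonicCentered (m * k) (f.comp g) := by
  have e : f.comp g - X ^ (m * k) = (∑ i ∈ Finset.range m, g ^ i * (X ^ k) ^ (m - 1 - i)) *
      (g - X ^ k) + (f - X ^ m).comp g := by
    rw [(Commute.all g (X ^ k)).geom_sum₂_mul, sub_comp, pow_comp, X_comp, ← pow_mul, mul_comm k m]
    ring
  obtain ⟨m, rfl⟩ : ∃ j, m = j + 1 := ⟨m - 1, by omega⟩
  obtain ⟨k, rfl⟩ : ∃ j, k = j + 1 := ⟨k - 1, by omega⟩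
  rw [MonicCentered, e]
  have hS : (∑ i ∈ Finset.range (m + 1), g ^ i * (X ^ (k + 1)) ^ (m + 1 - 1 - i)).natDegree
      ≤ m * (k + 1) := by
    refine natDegree_sum_le_of_forall_le _ _ fun i hi => ?_
    have hi : i ≤ m := by simpa [Nat.lt_succ_iff] using hi
    refine natDegree_mul_le.trans ?_
    rw [natDegree_pow, hg.natDegree_eq, ← pow_mul, natDegree_X_pow, mul_comm (k + 1), ← add_mul]
    exact Nat.mul_le_mul_right _ (by omega)
  refine (degree_add_le _ _).trans_lt (max_lt ?_ ?_)
  · by_cases h0 : g - X ^ (k + 1) = 0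
    · rw [h0, mul_zero, degree_zero]
      exact WithBot.bot_lt_coe _
    refine degree_le_natDegree.trans_lt (Nat.cast_lt.2 (natDegree_mul_le.trans_lt ?_))
    have h1 : (g - X ^ (k + 1)).natDegree < k := (natDegree_lt_iff_degree_lt h0).2 hg
    have h2 : (m + 1) * (k + 1) = m * (k + 1) + k + 1 := by ring
    omega
  · refine (degree_comp_lt hf hk hg.natDegree_eq).trans_le (Nat.cast_le.2 ?_)
    simp only [Nat.add_sub_cancel]
    have : (m + 1) * (k + 1) = m * (k + 1) + k + 1 := by ring
    omega

theorem eq_of_comp_eq (hm : 0 < m) (hk : 0 < k) (hf : MonicCentered m f)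
    (hf' : MonicCentered m f') (hg : MonicCentered k g) (hg' : MonicCentered k g')
    (h : f.comp g = f'.comp g') : f = f' ∧ g = g' := by
  have hgg : g = g' := by
    by_contra hne
    obtain ⟨m, rfl⟩ : ∃ j, m = j + 1 := ⟨m - 1, by omega⟩
    have e : (∑ i ∈ Finset.range (m + 1), g ^ i * g' ^ (m + 1 - 1 - i)) * (g - g') =
        (f' - X ^ (m + 1)).comp g' - (f - X ^ (m + 1)).comp g := by
      rw [(Commute.all g g').geom_sum₂_mul, sub_comp, sub_comp, pow_comp, pow_comp, X_comp, X_comp]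
      linear_combination h
    have hS : (∑ i ∈ Finset.range (m + 1), g ^ i * g' ^ (m + 1 - 1 - i)).coeff (m * k)
        = (m + 1 : ℕ) := by
      rw [finsetSum_coeff, Finset.sum_congr rfl (g := fun _ => (1 : ℂ))]
      · simp
      intro i hi
      have hi : i ≤ m := by simpa [Nat.lt_succ_iff] using hi
      have hmon : (g ^ i * g' ^ (m + 1 - 1 - i)).Monic := (hg.monic.pow i).mul (hg'.monic.pow _)
      have hdeg : (g ^ i * g' ^ (m + 1 - 1 - i)).natDegree = m * k := by
        rw [(hg.monic.pow i).natDegree_mul (hg'.monic.pow _), natDegree_pow, natDegree_pow,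
          hg.natDegree_eq, hg'.natDegree_eq, ← add_mul]
        congr 1
        omega
      rw [← hdeg]
      exact hmon
    have hlow := le_degree_of_ne_zero (hS.trans_ne (Nat.cast_ne_zero.2 m.succ_ne_zero))
    have hle : ((m * k : ℕ) : WithBot ℕ) ≤ ((f' - X ^ (m + 1)).comp g' -
        (f - X ^ (m + 1)).comp g).degree := by
      rw [← e]
      exact hlow.trans (degree_le_mul_left _ (sub_ne_zero.2 hne))
    refine absurd hle (not_le.2 ((degree_sub_le _ _).trans_lt (max_lt ?_ ?_)))
    · exact degree_comp_lt hf' hk hg'.natDegree_eq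
    · exact degree_comp_lt hf hk hg.natDegree_eq
  refine ⟨?_, hgg⟩
  subst hgg
  rw [← sub_eq_zero, ← sub_comp, comp_eq_zero_iff] at h
  rcases h with h | ⟨-, h⟩
  · exact sub_eq_zero.1 h
  · have := hg.natDegree_eq
    rw [h, natDegree_C] at this
    omega

end MonicCentered

theorem coeff_comp_affine {d : ℕ} (hd : 1 ≤ d) {F : ℂ[X]} (hF : F.natDegree ≤ d) (γ t : ℂ) :
    (F.comp (C γ * X + C t)).coeff d = F.coeff d * γ ^ d ∧
    (F.comp (C γ * X + C t)).coeff (d - 1) =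
      (F.coeff d * d * t + F.coeff (d - 1)) * γ ^ (d - 1) := by
  have key : ∀ j k, ((C γ * X + C t) ^ j : ℂ[X]).coeff k = γ ^ k * t ^ (j - k) * (j.choose k) := by
    intro j k
    have : (C γ * X + C t : ℂ[X]) = (X + C t).comp (C γ * X) := by simp
    rw [this, ← pow_comp, comp_C_mul_X_coeff, coeff_X_add_C_pow]
    ring
  have hsum : F.comp (C γ * X + C t) =
      ∑ i ∈ Finset.range (d + 1), C (F.coeff i) * (C γ * X + C t) ^ i := by
    rw [comp, eval₂_eq_sum_range' _ (Nat.lt_succ_of_le hF)]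
  obtain ⟨d, rfl⟩ : ∃ e, d = e + 1 := ⟨d - 1, by omega⟩
  have hlow : ∀ k, d ≤ k →
      ∑ i ∈ Finset.range d, F.coeff i * (γ ^ k * t ^ (i - k) * (i.choose k)) = 0 := by
    intro k hk
    refine Finset.sum_eq_zero fun i hi => ?_
    rw [Nat.choose_eq_zero_of_lt ((Finset.mem_range.1 hi).trans_le hk)]
    simp
  constructor
  · rw [hsum, finsetSum_coeff, Finset.sum_range_succ, Finset.sum_range_succ]
    simp only [coeff_C_mul, key]
    rw [hlow _ (by omega)]
    simp
  · rw [hsum, finsetSum_coeff, Finset.sum_range_succ, Finset.sum_range_succ]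
    simp only [coeff_C_mul, key]
    rw [hlow _ (by omega)]
    simp
    ring

theorem MonicCentered.of_affine {d : ℕ} (hd : 2 ≤ d) {F : ℂ[X]} (hF : F.natDegree ≤ d)
    {γ t : ℂ} (κ : ℂ) (hγ : γ ≠ 0) (htop : F.coeff d * γ ^ (d - 1) = 1)
    (hsub : F.coeff d * d * t + F.coeff (d - 1) = 0) :
    MonicCentered d (C γ⁻¹ * (F.comp (C γ * X + C t) - C κ)) := by
  obtain ⟨h1, h2⟩ := coeff_comp_affine (by omega : 1 ≤ d) hF γ t
  refine monicCentered_iff.2 fun k hk => ?_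
  rw [coeff_C_mul, coeff_sub, coeff_C_of_ne_zero (by omega), sub_zero, coeff_X_pow]
  rcases (by omega : k = d - 1 ∨ k = d ∨ d < k) with rfl | rfl | hlt
  · rw [h2, hsub, if_neg (by omega)]
    simp
  · rw [h1, if_pos rfl, ← mul_pow_sub_one (by omega : k ≠ 0) γ]
    field_simp
    linear_combination htop
  · rw [if_neg (by omega), coeff_eq_zero_of_natDegree_lt, mul_zero]
    refine lt_of_le_of_lt (natDegree_comp_le.trans ?_) hlt
    calc F.natDegree * (C γ * X + C t).natDegree ≤ d * 1 :=
          Nat.mul_le_mul hF natDegree_linear_le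
      _ = d := mul_one d

theorem AffConj.trans {f g h : ℂ[X]} (hfg : AffConj f g) (hgh : AffConj g h) : AffConj f h := by
  obtain ⟨u, v, hu, rfl⟩ := hfg
  obtain ⟨s, t, hs, rfl⟩ := hgh
  refine ⟨s * u, s * v + t, mul_ne_zero hs hu, Polynomial.funext fun x => ?_⟩
  simp only [eval_comp, eval_mul, eval_sub, eval_add, eval_C, eval_X]
  rw [show s * (u * x + v) + t = s * u * x + (s * v + t) by ring]
  field_simp
  ring

theorem SpecialPoly.of_affConj {d : ℕ} {f g : ℂ[X]} (hfg : AffConj f g) (hg : SpecialPoly d g) :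
    SpecialPoly d f :=
  hg.imp hfg.trans (Or.imp hfg.trans hfg.trans)

theorem SpecialPoly.exists_smul_dickson {D : ℕ} (hD : D ≠ 0) {f : ℂ[X]} (hf : SpecialPoly D f) :
    ∃ s b : ℂ, s ^ 2 = 1 ∧ b ^ D = b ∧ AffConj f (C s * dickson 1 b D) := by
  rcases hf with h | h | h
  · exact ⟨1, 0, by simp, by simp [hD], by simpa [dickson_one_zero_right D hD] using h⟩
  · exact ⟨1, 1, by simp, by simp, by simpa [ChebT] using h⟩
  · exact ⟨-1, 1, by simp, by simp, by simpa [ChebT] using h⟩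

theorem MonicCentered.eq_dickson_of_specialPoly {D : ℕ} (hD : 2 ≤ D) {f : ℂ[X]}
    (hf : MonicCentered D f) (hs : SpecialPoly D f) :
    ∃ a : ℂ, a ^ D = a ∧ f = dickson 1 a D := by
  obtain ⟨s, b, hs2, hb, u, v, hu, hfe⟩ := hs.exists_smul_dickson (by omega)
  have hs0 : s ≠ 0 := by rintro rfl; simp at hs2
  have hdick : MonicCentered D (dickson 1 b D) := by
    obtain ⟨e, rfl⟩ : ∃ e, D = e + 1 := ⟨D - 1, by omega⟩
    exact monicCentered_dickson b e
  have hev : ∀ x, u * f.eval x + v = s * (dickson 1 b D).eval (u * x + v) := by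
    intro x
    rw [hfe]
    simp only [eval_comp, eval_mul, eval_sub, eval_add, eval_C, eval_X]
    field_simp
    ring
  have hpoly : C u * f + C v = C s * (dickson 1 b D).comp (C u * X + C v) := by
    refine Polynomial.funext fun x => ?_
    simpa [eval_comp] using hev x
  obtain ⟨h1, h2⟩ := coeff_comp_affine (by omega : 1 ≤ D) hdick.natDegree_eq.le u v
  have c1 := congrArg (fun P => coeff P D) hpoly
  have c2 := congrArg (fun P => coeff P (D - 1)) hpoly
  simp only [coeff_add, coeff_C_mul, h1, h2] at c1 c2
  rw [monicCentered_iff.1 hf D (by omega), monicCentered_iff.1 hdick D (by omega),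
    coeff_C_of_ne_zero (by omega)] at c1
  rw [monicCentered_iff.1 hf (D - 1) (by omega), monicCentered_iff.1 hdick D (by omega),
    monicCentered_iff.1 hdick (D - 1) (by omega), coeff_C_of_ne_zero (by omega)] at c2
  rw [coeff_X_pow, if_pos rfl] at c1
  simp only [coeff_X_pow, if_neg (show ¬ D - 1 = D by omega), if_true] at c2
  have hv : v = 0 := by
    have : (D : ℂ) ≠ 0 := by exact_mod_cast (by omega : D ≠ 0)
    simpa [hu, hs0, this] using c2.symm
  subst hv
  have hu2 : (u ^ 2) ^ D = u ^ 2 := by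
    linear_combination (-(s * u ^ D) - u) * c1 - (u ^ D) ^ 2 * hs2
  refine ⟨b / u ^ 2, by rw [div_pow, hb, hu2], Polynomial.funext fun x => ?_⟩
  have h3 := dickson_one_eval_smul u (b / u ^ 2) x D
  rw [mul_div_cancel₀ _ (pow_ne_zero 2 hu)] at h3
  have h4 := hev x
  rw [add_zero, add_zero, h3] at h4
  refine mul_left_cancel₀ hu ?_
  linear_combination h4 - (dickson 1 (b / u ^ 2) D).eval x * c1

/-- The total degree of `q`, seen as a polynomial in two variables, is at most `d`. -/
def TotalDegreeLE (d : ℕ) (q : ℂ[X][X]) : Prop :=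
  ∀ k, q.coeff k ≠ 0 → (q.coeff k).natDegree + k ≤ d

namespace TotalDegreeLE

variable {d e : ℕ} {q r : ℂ[X][X]}

theorem mono (hq : TotalDegreeLE d q) (h : d ≤ e) : TotalDegreeLE e q :=
  fun k hk => (hq k hk).trans h

theorem natDegree_coeff_le (hq : TotalDegreeLE d q) (k : ℕ) : (q.coeff k).natDegree ≤ d - k := by
  by_cases h : q.coeff k = 0
  · simp [h]
  · have := hq k h
    omega

theorem natDegree_le (hq : TotalDegreeLE d q) : q.natDegree ≤ d :=
  natDegree_le_iff_coeff_eq_zero.2 fun k hk => by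
    by_contra h
    have := hq k h
    omega

theorem of_natDegree_le {a : ℂ[X]} (h : a.natDegree ≤ d) : TotalDegreeLE d (C a) := by
  intro k hk
  rcases Nat.eq_zero_or_pos k with rfl | hpos
  · simpa using h
  · exact absurd (coeff_C_of_ne_zero hpos.ne') hk

theorem X_le : TotalDegreeLE 1 X := by
  intro k hk
  rw [coeff_X] at hk ⊢
  split_ifs at hk ⊢ with h
  · simp [← h]
  · exact absurd rfl hk

theorem add (hq : TotalDegreeLE d q) (hr : TotalDegreeLE d r) : TotalDegreeLE d (q + r) := by
  intro k hk
  have hkd : k ≤ d := by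
    by_contra hlt
    refine hk ?_
    rw [coeff_add, coeff_eq_zero_of_natDegree_lt (hq.natDegree_le.trans_lt (not_le.1 hlt)),
      coeff_eq_zero_of_natDegree_lt (hr.natDegree_le.trans_lt (not_le.1 hlt)), add_zero]
  have := natDegree_add_le_of_degree_le (hq.natDegree_coeff_le k) (hr.natDegree_coeff_le k)
  rw [coeff_add]
  omega

theorem sum {ι : Type*} (s : Finset ι) (g : ι → ℂ[X][X]) (h : ∀ i ∈ s, TotalDegreeLE d (g i)) :
    TotalDegreeLE d (∑ i ∈ s, g i) :=
  Finset.sum_induction g _ (fun _ _ => add) (fun k hk => absurd (coeff_zero k) hk) h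

theorem mul (hq : TotalDegreeLE d q) (hr : TotalDegreeLE e r) : TotalDegreeLE (d + e) (q * r) := by
  intro k hk
  have hkd : k ≤ d + e := by
    by_contra hlt
    refine hk (coeff_eq_zero_of_natDegree_lt (lt_of_le_of_lt ?_ (not_le.1 hlt)))
    exact natDegree_mul_le.trans (Nat.add_le_add hq.natDegree_le hr.natDegree_le)
  suffices h : ((q * r).coeff k).natDegree ≤ d + e - k by omega
  rw [coeff_mul]
  refine natDegree_sum_le_of_forall_le _ _ fun ij hij => ?_
  have hij : ij.1 + ij.2 = k := by simpa using hij
  by_cases h1 : q.coeff ij.1 = 0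
  · simp [h1]
  by_cases h2 : r.coeff ij.2 = 0
  · simp [h2]
  have := hq _ h1
  have := hr _ h2
  have := natDegree_mul_le (p := q.coeff ij.1) (q := r.coeff ij.2)
  omega

theorem pow (hr : TotalDegreeLE 1 r) (k : ℕ) : TotalDegreeLE k (r ^ k) := by
  induction k with
  | zero => simpa using of_natDegree_le (a := 1) (d := 0) (by simp)
  | succ k ih => simpa [pow_succ] using ih.mul hr

theorem comp (hq : TotalDegreeLE d q) (hr : TotalDegreeLE 1 r) : TotalDegreeLE d (q.comp r) := by
  rw [Polynomial.comp, eval₂_eq_sum_range]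
  refine sum _ _ fun k hk => ?_
  have hk : k ≤ d := (Nat.lt_succ_iff.1 (Finset.mem_range.1 hk)).trans hq.natDegree_le
  exact ((of_natDegree_le (hq.natDegree_coeff_le k)).mul (hr.pow k)).mono (by omega)

end TotalDegreeLE

theorem fiber_coeff (q : ℂ[X][X]) (z : ℂ) (k : ℕ) : (fiber q z).coeff k = (q.coeff k).eval z := by
  simp [fiber, coeff_map]

theorem exists_monicCentered_fiber {d : ℕ} (hd : 2 ≤ d) {p : ℂ[X]} {q : ℂ[X][X]}
    (hreg : IsRegularSkew d p q) :
    ∃ γ ε δ : ℂ, ∃ r : ℂ[X][X], γ ≠ 0 ∧ TotalDegreeLE d r ∧ ∀ z,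
      MonicCentered d (fiber r z) ∧
      fiber r z = C γ⁻¹ * ((fiber q z).comp (C γ * X + C (ε * z + δ)) - C (ε * p.eval z + δ)) := by
  obtain ⟨hp, hq, hlead⟩ := hreg
  have hq : TotalDegreeLE d q := hq
  have hd0 : (d : ℂ) ≠ 0 := by exact_mod_cast (by omega : d ≠ 0)
  obtain ⟨c, hc⟩ : ∃ c, q.coeff d = C c :=
    ⟨_, eq_C_of_natDegree_eq_zero (by have := hq _ hlead; omega)⟩
  have hc0 : c ≠ 0 := by
    rintro rfl
    exact hlead (by simpa using hc)
  obtain ⟨b, b', hb⟩ := exists_eq_X_add_C_of_natDegree_le_one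
    (show (q.coeff (d - 1)).natDegree ≤ 1 by have := hq.natDegree_coeff_le (d - 1); omega)
  obtain ⟨γ, hγ⟩ := IsAlgClosed.exists_pow_nat_eq c⁻¹ (by omega : 0 < d - 1)
  have hγ0 : γ ≠ 0 := by
    rintro rfl
    rw [zero_pow (by omega)] at hγ
    exact inv_ne_zero hc0 hγ.symm
  set ε : ℂ := -b / (c * d) with hε
  set δ : ℂ := -b' / (c * d) with hδ
  have hfib : ∀ z, fiber (C (C γ⁻¹) * (q.comp (C (C γ) * X + C (C ε * X + C δ)) +
      C (-(C ε * p + C δ)))) z =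
      C γ⁻¹ * ((fiber q z).comp (C γ * X + C (ε * z + δ)) - C (ε * p.eval z + δ)) := by
    intro z
    simp [fiber, map_comp, sub_eq_add_neg]
  refine ⟨γ, ε, δ, _, hγ0, ?_, fun z => ⟨?_, hfib z⟩⟩
  · rw [← zero_add d]
    refine (TotalDegreeLE.of_natDegree_le (by simp)).mul ((hq.comp ?_).add ?_)
    · refine TotalDegreeLE.add ?_ (TotalDegreeLE.of_natDegree_le natDegree_linear_le)
      simpa using (TotalDegreeLE.of_natDegree_le (a := C γ) (d := 0) (by simp)).mul
        TotalDegreeLE.X_le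
    · refine TotalDegreeLE.of_natDegree_le ?_
      rw [natDegree_neg, natDegree_add_C]
      exact (natDegree_C_mul_le _ _).trans hp.le
  · rw [hfib]
    refine MonicCentered.of_affine (F := fiber q z) hd (natDegree_map_le.trans hq.natDegree_le) _ hγ0 ?_ ?_
    · rw [fiber_coeff, hc, eval_C, hγ, mul_inv_cancel₀ hc0]
    · rw [fiber_coeff, fiber_coeff, hc, hb, hε, hδ]
      simp
      field_simp
      ring

theorem monicCentered_QIter {d : ℕ} (hd : 2 ≤ d) (p : ℂ[X]) {r : ℂ[X][X]}
    (hr : ∀ z, MonicCentered d (fiber r z)) (n : ℕ) (z : ℂ) :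
    MonicCentered (d ^ n) (QIter p r n z) := by
  induction n generalizing z with
  | zero => simp [MonicCentered, QIter]
  | succ n ih =>
    rw [QIter, pow_succ]
    exact (ih (p.eval z)).comp (pow_pos (by omega) n) (by omega) (hr z)

theorem QIter_conj {p : ℂ[X]} {q r : ℂ[X][X]} {γ ε δ : ℂ} (hγ : γ ≠ 0)
    (hr : ∀ z, fiber r z =
      C γ⁻¹ * ((fiber q z).comp (C γ * X + C (ε * z + δ)) - C (ε * p.eval z + δ)))
    (n : ℕ) (z : ℂ) :
    QIter p r n z = C γ⁻¹ * ((QIter p q n z).comp (C γ * X + C (ε * z + δ)) -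
      C (ε * (polyIter p n).eval z + δ)) := by
  refine Polynomial.funext fun w => ?_
  induction n generalizing z w with
  | zero =>
    simp [QIter, polyIter]
    field_simp
  | succ n ih =>
    rw [QIter, eval_comp, ih, hr]
    simp only [QIter, polyIter, eval_comp, eval_mul, eval_sub, eval_add, eval_C, eval_X]
    congr 4
    field_simp
    ring

theorem fiber_eq_dickson_of_QIter_eq {d : ℕ} (hd : 2 ≤ d) {p : ℂ[X]} {r : ℂ[X][X]}
    (hr : ∀ z, MonicCentered d (fiber r z)) {n : ℕ} {z a : ℂ}
    (h : QIter p r (n + 1) z = dickson 1 a (d ^ (n + 1))) :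
    fiber r z = dickson 1 a d ∧ QIter p r n (p.eval z) = dickson 1 (a ^ d) (d ^ n) := by
  have hmc : ∀ {b : ℂ} {D : ℕ}, 0 < D → MonicCentered D (dickson 1 b D) := by
    intro b D hD
    obtain ⟨e, rfl⟩ : ∃ e, D = e + 1 := ⟨D - 1, by omega⟩
    exact monicCentered_dickson b e
  have hpos : 0 < d ^ n := pow_pos (by omega) n
  rw [QIter, pow_succ, dickson_one_mul] at h
  exact (MonicCentered.eq_of_comp_eq hpos (by omega) (monicCentered_QIter hd p hr n _)
    (hmc hpos) (hr z) (hmc (by omega)) h).symm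

theorem exists_dickson_normal_form {d : ℕ} (hd : 2 ≤ d) {p : ℂ[X]} {q : ℂ[X][X]}
    (hreg : IsRegularSkew d p q)
    (hinf : {z₀ : ℂ | ∃ n : ℕ, 0 < n ∧ (polyIter p n).eval z₀ = z₀ ∧
        (∀ m : ℕ, 0 < m → m < n → (polyIter p m).eval z₀ ≠ z₀) ∧
        SpecialPoly (d ^ n) (QIter p q n z₀)}.Infinite) :
    ∃ γ ε δ : ℂ, ∃ A : ℂ[X], γ ≠ 0 ∧ A.natDegree ≤ 2 ∧ A.comp p = A ^ d ∧
      ∀ z w, (fiber q z).eval (γ * w + (ε * z + δ)) =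
        γ * (dickson 1 (A.eval z) d).eval w + (ε * p.eval z + δ) := by
  obtain ⟨γ, ε, δ, r, hγ, hdeg, hr⟩ := exists_monicCentered_fiber hd hreg
  have hmc := fun z => (hr z).1
  have hd0 : (d : ℂ) ≠ 0 := by exact_mod_cast (by omega : d ≠ 0)
  set A : ℂ[X] := C (-(d : ℂ)⁻¹) * r.coeff (d - 2) with hA
  have hAd : A.natDegree ≤ 2 := by
    have := hdeg.natDegree_coeff_le (d - 2)
    have := natDegree_C_mul_le (-(d : ℂ)⁻¹) (r.coeff (d - 2))
    rw [hA]
    omega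
  have hAeq : ∀ {z a}, fiber r z = dickson 1 a d → A.eval z = a := by
    intro z a h
    have h1 := congrArg (fun P => coeff P (d - 2)) h
    obtain ⟨e, rfl⟩ : ∃ e, d = e + 2 := ⟨d - 2, by omega⟩
    simp only [Nat.add_sub_cancel, fiber_coeff, coeff_dickson_one] at h1
    rw [hA, eval_mul, eval_C, Nat.add_sub_cancel, h1]
    push_cast at hd0 ⊢
    field_simp
  have hgood : {z : ℂ | fiber r z = dickson 1 (A.eval z) d ∧
      A.eval (p.eval z) = A.eval z ^ d}.Infinite := by
    refine hinf.mono ?_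
    rintro z ⟨n, hn, hper, -, hspec⟩
    obtain ⟨n, rfl⟩ : ∃ e, n = e + 1 := ⟨n - 1, by omega⟩
    have hconj : AffConj (QIter p r (n + 1) z) (QIter p q (n + 1) z) := by
      refine ⟨γ, ε * z + δ, hγ, ?_⟩
      rw [QIter_conj hγ (fun z => (hr z).2) (n + 1) z, hper]
      simp [sub_comp]
    obtain ⟨a, ha, hQ⟩ := (monicCentered_QIter hd p hmc (n + 1) z).eq_dickson_of_specialPoly
      (hd.trans (Nat.le_self_pow n.succ_ne_zero d)) (hspec.of_affConj hconj)
    obtain ⟨h1, h2⟩ := fiber_eq_dickson_of_QIter_eq hd hmc hQ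
    have hAz := hAeq h1
    refine ⟨by rw [hAz, h1], ?_⟩
    rw [hAz]
    rcases n with _ | n
    · have hpz : p.eval z = z := by simpa [polyIter] using hper
      rw [hpz, hAz]
      simpa using ha.symm
    · exact hAeq (fiber_eq_dickson_of_QIter_eq hd hmc h2).1
  have hcomp : A.comp p = A ^ d :=
    eq_of_infinite_eval_eq _ _ (hgood.mono fun z hz => by simpa [eval_comp] using hz.2)
  have hfib : ∀ z, fiber (dickson 1 A d) z = dickson 1 (A.eval z) d := fun z => by
    rw [fiber, map_dickson, coe_evalRingHom]
  have hrd : r = dickson 1 A d := by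
    refine Polynomial.ext fun k => eq_of_infinite_eval_eq _ _ (hgood.mono fun z hz => ?_)
    rw [Set.mem_ofPred_eq, ← fiber_coeff, ← fiber_coeff, hfib, hz.1]
  refine ⟨γ, ε, δ, A, hγ, hAd, hcomp, fun z w => ?_⟩
  rw [← hfib, ← hrd, (hr z).2]
  simp only [eval_comp, eval_mul, eval_sub, eval_add, eval_C, eval_X]
  field_simp
  ring

theorem triangConj_of_dickson_normal_form {d : ℕ} {p : ℂ[X]} {q : ℂ[X][X]} {γ ε δ : ℂ} {A : ℂ[X]}
    (hγ : γ ≠ 0)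
    (hq : ∀ z w, (fiber q z).eval (γ * w + (ε * z + δ)) =
      γ * (dickson 1 (A.eval z) d).eval w + (ε * p.eval z + δ))
    {α β μ : ℂ} (hα : α ≠ 0) (hμ : μ ≠ 0) {P : ℂ → ℂ} {G : ℂ × ℂ → ℂ}
    (hP : ∀ z, p.eval (α * z + β) = α * P z + β)
    (hG : ∀ z w, (dickson 1 (A.eval (α * z + β)) d).eval (μ * w) = μ * G (z, w)) :
    TriangConj (skewMap p q) fun zw => (P zw.1, G zw) := by
  refine ⟨α, β, γ * μ, ε * β + δ, ε * α, hα, mul_ne_zero hγ hμ, ?_⟩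
  rintro ⟨z, w⟩
  have h := hq (α * z + β) (μ * w)
  rw [hG, hP] at h
  simp only [skewMap, hP]
  rw [show ε * α * z + γ * μ * w + (ε * β + δ) = γ * (μ * w) + (ε * (α * z + β) + δ) by ring, h]
  congr 1
  ring

theorem AffConj.exists_eval_affine {p P : ℂ[X]} (h : AffConj p P) :
    ∃ α β : ℂ, α ≠ 0 ∧ ∀ z, p.eval (α * z + β) = α * P.eval z + β := by
  obtain ⟨u, v, hu, rfl⟩ := h
  refine ⟨u⁻¹, -v / u, inv_ne_zero hu, fun z => ?_⟩
  simp only [eval_comp, eval_mul, eval_sub, eval_add, eval_C, eval_X]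
  rw [show u * (u⁻¹ * z + -v / u) + v = z by field_simp; ring]
  field_simp
  ring

theorem eq_zero_of_sq_add_C_eq {d : ℕ} (hd : 2 ≤ d) {P Z : ℂ[X]} {c e : ℂ} (hc : c ≠ 0)
    (hP : P.natDegree = d) (hZ : Z.natDegree = 1)
    (h : C c * (P ^ 2 + C e) = C c ^ d * (Z ^ 2 + C e) ^ d) : e = 0 := by
  by_contra he
  have hdvd : Z ^ 2 + C e ∣ P ^ 2 + C e := by
    have : Z ^ 2 + C e ∣ C c * (P ^ 2 + C e) := by
      rw [h]
      exact (dvd_pow_self _ (by omega)).mul_left _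
    exact ((isUnit_C.2 hc.isUnit).dvd_mul_left).1 this
  have hcop : IsCoprime (Z ^ 2 + C e) P := by
    have h1 : IsCoprime (P ^ 2 + C e) P := by
      refine ⟨C e⁻¹, -C e⁻¹ * P, ?_⟩
      have : C e⁻¹ * C e = (1 : ℂ[X]) := by rw [← C_mul, inv_mul_cancel₀ he, C_1]
      linear_combination this
    exact h1.of_isCoprime_of_dvd_left hdvd
  have hder := congrArg derivative h
  have hdvd' : (Z ^ 2 + C e) ^ (d - 1) ∣ P * derivative P := by
    have h2 : (Z ^ 2 + C e) ^ (d - 1) ∣ C (c * 2) * (P * derivative P) := by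
      have hl : C (c * 2) * (P * derivative P) = derivative (C c * (P ^ 2 + C e)) := by
        simp [derivative_pow]
        ring
      rw [hl, hder, ← C_pow, derivative_C_mul, derivative_pow]
      exact ((dvd_mul_left _ _).mul_right _).mul_left _
    exact ((isUnit_C.2 (mul_ne_zero hc two_ne_zero).isUnit).dvd_mul_left).1 h2
  have hfin := (hcop.pow_left (m := d - 1)).dvd_of_dvd_mul_left hdvd'
  have hP' : derivative P ≠ 0 := by
    intro h0
    have := derivative_eq_zero.1 h0
    omega
  have hle := natDegree_le_of_dvd hfin hP'
  have hlt := natDegree_derivative_lt (show P.natDegree ≠ 0 by omega)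
  rw [natDegree_pow, natDegree_add_C, natDegree_pow, hZ] at hle
  omega

theorem exists_sq_normal_form {d : ℕ} (hd : 2 ≤ d) {p A : ℂ[X]} (hp : p.natDegree = d)
    (hA : A.natDegree = 2) (h : A.comp p = A ^ d) :
    ∃ α β ζ : ℂ, α ≠ 0 ∧ ζ ^ (d - 1) = 1 ∧ (∀ z, p.eval (α * z + β) = α * z ^ d + β) ∧
      ∀ z, A.eval (α * z + β) = ζ * z ^ 2 := by
  have hc : A.coeff 2 ≠ 0 := by
    rw [← hA]
    exact leadingCoeff_ne_zero.2 (by rintro rfl; simp at hA)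
  have hquad := eq_quadratic_of_degree_le_two (degree_le_of_natDegree_le hA.le)
  generalize A.coeff 2 = c at hc hquad
  generalize A.coeff 1 = c₁ at hquad
  generalize A.coeff 0 = c₀ at hquad
  obtain ⟨s, e, hAs⟩ : ∃ s e : ℂ, A = C c * ((X - C s) ^ 2 + C e) := by
    refine ⟨-c₁ / (2 * c), c₀ / c - (c₁ / (2 * c)) ^ 2, Polynomial.funext fun x => ?_⟩
    rw [hquad]
    simp
    field_simp
    ring
  have hcomp : C c * ((p - C s) ^ 2 + C e) = C c ^ d * ((X - C s) ^ 2 + C e) ^ d := by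
    rw [← mul_pow, ← hAs, ← h, hAs]
    simp
  obtain rfl : e = 0 := eq_zero_of_sq_add_C_eq hd hc (by rw [natDegree_sub_C, hp])
    (natDegree_X_sub_C s) hcomp
  obtain ⟨κ, hκ⟩ := IsAlgClosed.exists_pow_nat_eq (c ^ (d - 1)) (n := 2) (by norm_num)
  have hfac : (p - C s - C κ * (X - C s) ^ d) * (p - C s - C (-κ) * (X - C s) ^ d) = 0 := by
    have hc' : (C c : ℂ[X]) ≠ 0 := C_ne_zero.2 hc
    refine mul_left_cancel₀ hc' ?_
    have hκ' : (C κ : ℂ[X]) ^ 2 = C c ^ (d - 1) := by rw [← C_pow, hκ, C_pow]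
    have hcd : (C c : ℂ[X]) * C c ^ (d - 1) = C c ^ d := mul_pow_sub_one (by omega) _
    simp only [C_0, add_zero, C_neg] at hcomp ⊢
    rw [pow_right_comm] at hcomp
    linear_combination hcomp - C c * ((X - C s) ^ d) ^ 2 * hκ' - ((X - C s) ^ d) ^ 2 * hcd
  obtain ⟨κ', hκ', hpe⟩ : ∃ κ' : ℂ, κ' ^ 2 = c ^ (d - 1) ∧ p - C s = C κ' * (X - C s) ^ d := by
    rcases mul_eq_zero.1 hfac with h0 | h0
    · exact ⟨κ, hκ, sub_eq_zero.1 h0⟩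
    · exact ⟨-κ, by rw [neg_sq, hκ], sub_eq_zero.1 h0⟩
  have hκ0 : κ' ≠ 0 := by
    rintro rfl
    exact pow_ne_zero (d - 1) hc (by rw [← hκ']; simp)
  obtain ⟨α, hα⟩ := IsAlgClosed.exists_pow_nat_eq κ'⁻¹ (by omega : 0 < d - 1)
  have hα0 : α ≠ 0 := by
    rintro rfl
    rw [zero_pow (by omega)] at hα
    exact inv_ne_zero hκ0 hα.symm
  refine ⟨α, s, c * α ^ 2, hα0, ?_, fun z => ?_, fun z => ?_⟩
  · rw [mul_pow, ← pow_mul, mul_comm 2, pow_mul, hα, ← hκ']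
    field_simp
  · have hz := congrArg (eval (α * z + s)) hpe
    simp only [eval_sub, eval_mul, eval_pow, eval_C, eval_X, add_sub_cancel_right, mul_pow] at hz
    rw [← mul_pow_sub_one (by omega : d ≠ 0) α, hα] at hz
    field_simp at hz
    linear_combination hz
  · rw [hAs]
    simp
    ring

theorem stmt1 (d : ℕ) (hd : 2 ≤ d) (p : Polynomial ℂ) (q : Polynomial (Polynomial ℂ))
    (hreg : IsRegularSkew d p q) (hp : SpecialPoly d p)
    (hinf : {z₀ : ℂ | ∃ n : ℕ, 0 < n ∧ (polyIter p n).eval z₀ = z₀ ∧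
        (∀ m : ℕ, 0 < m → m < n → (polyIter p m).eval z₀ ≠ z₀) ∧
        SpecialPoly (d ^ n) (QIter p q n z₀)}.Infinite) :
    SpecialSkew d (skewMap p q) := by
  obtain ⟨γ, ε, δ, A, hγ, hAd, hcomp, hq⟩ := exists_dickson_normal_form hd hreg hinf
  rcases (by omega : A.natDegree = 0 ∨ A.natDegree = 1 ∨ A.natDegree = 2) with h0 | h1 | h2
  · left
    obtain ⟨P, hPmem, α, β, hα, hP⟩ : ∃ P : ℂ[X], (P = X ^ d ∨ P = ChebT d ∨ P = -ChebT d) ∧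
        ∃ α β : ℂ, α ≠ 0 ∧ ∀ z, p.eval (α * z + β) = α * P.eval z + β := by
      rcases hp with h | h | h
      · exact ⟨_, Or.inl rfl, h.exists_eval_affine⟩
      · exact ⟨_, Or.inr (Or.inl rfl), h.exists_eval_affine⟩
      · exact ⟨_, Or.inr (Or.inr rfl), h.exists_eval_affine⟩
    obtain ⟨a, rfl⟩ : ∃ a, A = C a := ⟨_, eq_C_of_natDegree_eq_zero h0⟩
    have ha : a = a ^ d := by
      rw [C_comp, ← C_pow] at hcomp
      exact C_injective hcomp
    by_cases ha0 : a = 0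
    · refine ⟨P, X ^ d, hPmem, Or.inl rfl, triangConj_of_dickson_normal_form hγ hq (β := β) hα
        one_ne_zero hP (G := fun zw => (X ^ d : ℂ[X]).eval zw.2) fun z w => ?_⟩
      rw [eval_C, ha0, dickson_one_zero_right d (by omega)]
      simp
    · obtain ⟨μ, hμ⟩ := IsAlgClosed.exists_pow_nat_eq a (n := 2) (by norm_num)
      have hμ0 : μ ≠ 0 := by
        rintro rfl
        exact ha0 (by simpa using hμ.symm)
      have hdick : ∀ w, (dickson 1 a d).eval (μ * w) = μ ^ d * (ChebT d).eval w := fun w => by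
        rw [ChebT, ← dickson_one_eval_smul, mul_one, hμ]
      have hsq : (μ ^ d - μ) * (μ ^ d + μ) = 0 := by
        have h : (μ ^ d) ^ 2 = μ ^ 2 := by rw [pow_right_comm, hμ, ← ha]
        linear_combination h
      rcases mul_eq_zero.1 hsq with h | h
      · refine ⟨P, ChebT d, hPmem, Or.inr (Or.inl rfl), triangConj_of_dickson_normal_form hγ hq
          (β := β) hα hμ0 hP (G := fun zw => (ChebT d).eval zw.2) fun z w => ?_⟩
        rw [eval_C, hdick, sub_eq_zero.1 h]
      · refine ⟨P, -ChebT d, hPmem, Or.inr (Or.inr rfl), triangConj_of_dickson_normal_form hγ hq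
          (β := β) hα hμ0 hP (G := fun zw => (-ChebT d).eval zw.2) fun z w => ?_⟩
        rw [eval_C, hdick, eq_neg_of_add_eq_zero_left h, eval_neg]
        ring
  · right
    obtain ⟨b, e, rfl⟩ := exists_eq_X_add_C_of_natDegree_le_one h1.le
    have hb : b ≠ 0 := by
      rintro rfl
      simp at h1
    have hAz : ∀ z, (C b * X + C e).eval (b⁻¹ * z + -e / b) = z := fun z => by
      simp
      field_simp
      ring
    refine ⟨1, 1, one_pow _, Or.inl rfl, triangConj_of_dickson_normal_form hγ hq
      (β := -e / b) (inv_ne_zero hb) one_ne_zero (P := fun z => z ^ d)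
      (G := fun zw => (dickson 1 (1 * zw.1 ^ 1) d).eval zw.2) (fun z => ?_) fun z w => ?_⟩
    · have hz := congrArg (eval (b⁻¹ * z + -e / b)) hcomp
      rw [eval_pow, hAz, eval_comp] at hz
      simp only [eval_add, eval_mul, eval_C, eval_X] at hz
      refine mul_left_cancel₀ hb ?_
      rw [mul_add, mul_div_cancel₀ _ hb, mul_inv_cancel_left₀ hb]
      linear_combination hz
    · rw [hAz]
      simp
  · right
    obtain ⟨α, β, ζ, hα, hζ, hP, hAz⟩ := exists_sq_normal_form hd hreg.1 h2 hcomp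
    refine ⟨ζ, 2, hζ, Or.inr rfl, triangConj_of_dickson_normal_form hγ hq hα one_ne_zero
      (P := fun z => z ^ d) (G := fun zw => (dickson 1 (ζ * zw.1 ^ 2) d).eval zw.2) hP
      fun z w => ?_⟩
    rw [hAz]
    simp
end
end

section
/- Let d ≥ 2 be an integer and let ζ ∈ ℂ. The one-variable polynomial D_d(x,ζ) is affinely conjugate to T_d or to −T_d if and only if ζ^{d−1} = 1. -/
open Polynomial

noncomputable section

/-- Homogeneity of the Dickson polynomials: `D_n(s x, s² a) = sⁿ D_n(x, a)`. -/
theorem dickson_comp_C_mul_X {R : Type*} [CommRing R] (k : ℕ) (s a : R) (n : ℕ) :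
    (dickson k (s ^ 2 * a) n).comp (C s * X) = C (s ^ n) * dickson k a n := by
  induction n using Nat.twoStepInduction with
  | zero => simp [dickson_zero, sub_comp]
  | one => simp
  | more n h₀ h₁ =>
    rw [dickson_add_two, dickson_add_two, sub_comp, mul_comp, mul_comp, h₀, h₁, X_comp, C_comp]
    simp only [C_mul, C_pow]
    ring

/-- The two leading terms of a Dickson polynomial of the first kind. -/
theorem exists_dickson_one_eq_add {R : Type*} [CommRing R] (a : R) (n : ℕ) :
    ∃ r : R[X], r.degree < n ∧
      dickson 1 a (n + 2) = X ^ (n + 2) - C (((n : R) + 2) * a) * X ^ n + r := by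
  induction n using Nat.twoStepInduction with
  | zero =>
    refine ⟨0, by simp, ?_⟩
    simp only [dickson_two, Nat.cast_zero, zero_add, C_mul, map_ofNat, Nat.cast_one]
    ring
  | one =>
    refine ⟨0, by simp, ?_⟩
    rw [dickson_add_two, dickson_two, dickson_one]
    simp only [C_mul, C_add, map_ofNat, map_one, Nat.cast_one]
    ring
  | more n h₀ h₁ =>
    obtain ⟨r₀, hr₀, h₀⟩ := h₀
    obtain ⟨r₁, hr₁, h₁⟩ := h₁
    refine ⟨X * r₁ + C (((n : R) + 2) * a ^ 2) * X ^ n - C a * r₀, ?_, ?_⟩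
    · rw [← mem_degreeLT] at *
      refine sub_mem (add_mem ?_ ?_) ?_
      · rw [mem_degreeLT, degree_lt_iff_coeff_zero] at *
        rintro (_ | m) hm
        · simp
        · rw [coeff_X_mul]
          exact hr₁ m (by omega)
      · rw [mem_degreeLT]
        exact (degree_C_mul_X_pow_le _ _).trans_lt (by exact_mod_cast (by omega : n < n + 2))
      · rw [← smul_eq_C_mul]
        exact Submodule.smul_mem _ _ (degreeLT_mono (by omega) hr₀)
    · rw [dickson_add_two, h₀, h₁]
      simp only [C_mul, C_add, C_pow, map_ofNat, map_natCast, map_one, Nat.cast_add,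
        Nat.cast_one, Nat.cast_ofNat]
      ring

theorem coeff_dickson_one_self {R : Type*} [CommRing R] (a : R) (n : ℕ) :
    (dickson 1 a (n + 2)).coeff (n + 2) = 1 := by
  obtain ⟨r, hr, h⟩ := exists_dickson_one_eq_add a n
  rw [degree_lt_iff_coeff_zero] at hr
  rw [h, coeff_add, coeff_sub, coeff_C_mul_X_pow, coeff_X_pow, hr (n + 2) (by omega)]
  simp

theorem coeff_dickson_one_sub_one {R : Type*} [CommRing R] (a : R) (n : ℕ) :
    (dickson 1 a (n + 2)).coeff (n + 1) = 0 := by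
  obtain ⟨r, hr, h⟩ := exists_dickson_one_eq_add a n
  rw [degree_lt_iff_coeff_zero] at hr
  rw [h, coeff_add, coeff_sub, coeff_C_mul_X_pow, coeff_X_pow, hr (n + 1) (by omega)]
  simp

theorem coeff_dickson_one_sub_two {R : Type*} [CommRing R] (a : R) (n : ℕ) :
    (dickson 1 a (n + 2)).coeff n = -(((n : R) + 2) * a) := by
  obtain ⟨r, hr, h⟩ := exists_dickson_one_eq_add a n
  rw [degree_lt_iff_coeff_zero] at hr
  rw [h, coeff_add, coeff_sub, coeff_C_mul_X_pow, coeff_X_pow, hr n le_rfl]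
  simp

theorem natDegree_dickson_one_le {R : Type*} [CommRing R] (a : R) (n : ℕ) :
    (dickson 1 a (n + 2)).natDegree ≤ n + 2 := by
  obtain ⟨r, hr, h⟩ := exists_dickson_one_eq_add a n
  rw [degree_lt_iff_coeff_zero] at hr
  rw [natDegree_le_iff_coeff_eq_zero]
  intro m hm
  rw [h, coeff_add, coeff_sub, coeff_C_mul_X_pow, coeff_X_pow, hr m (by omega),
    if_neg (by omega), if_neg (by omega)]
  simp

/-- The second coefficient of a polynomial after an affine substitution. -/
theorem coeff_comp_affine_s7 {R : Type*} [CommRing R] (p : R[X]) (u v : R) (m : ℕ)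
    (hp : p.natDegree ≤ m + 1) :
    (p.comp (C u * X + C v)).coeff m =
      u ^ m * (p.coeff m + (m + 1) * v * p.coeff (m + 1)) := by
  have hcomp : p.comp (C u * X + C v) = ((taylor v p).comp (C u * X)) := by
    rw [taylor_apply, comp_assoc]
    simp
  rw [hcomp, comp_C_mul_X_coeff, taylor_coeff, mul_comm, eval_eq_sum_range' (n := 2)]
  · simp [Finset.sum_range_succ, hasseDeriv_coeff, add_comm 1 m]
    ring
  · have := natDegree_hasseDeriv_le p m
    omega

/-- An affine conjugacy from `D_d(x, ζ)` to `ε T_d` with `ε² = 1` forces `ζ^(d-1) = 1`. -/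
theorem pow_eq_one_of_affConj {n : ℕ} {ζ ε : ℂ} (hε : ε ^ 2 = 1)
    (h : AffConj (dickson 1 ζ (n + 2)) (C ε * ChebT (n + 2))) : ζ ^ (n + 1) = 1 := by
  obtain ⟨u, v, hu, h⟩ := h
  have hε₀ : ε ≠ 0 := by
    rintro rfl
    simp at hε
  have hn : (n : ℂ) + 2 ≠ 0 := by exact_mod_cast (by omega : n + 2 ≠ 0)
  have hcoeff (m : ℕ) : (dickson 1 ζ (n + 2)).coeff m =
      u⁻¹ * (ε * ((ChebT (n + 2)).comp (C u * X + C v)).coeff m - (C v).coeff m) := by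
    conv_lhs => rw [h]
    simp only [mul_comp, C_comp, sub_comp, X_comp, coeff_C_mul, coeff_sub]
  have hdeg : (ChebT (n + 2)).natDegree ≤ n + 2 := natDegree_dickson_one_le 1 n
  have hv : v = 0 := by
    have := hcoeff (n + 1)
    rw [coeff_comp_affine_s7 _ _ _ _ hdeg, ChebT, coeff_dickson_one_sub_one,
      coeff_dickson_one_sub_one, coeff_dickson_one_self, coeff_C_succ] at this
    have hn' : (n : ℂ) + 1 + 1 ≠ 0 := by rwa [add_assoc, one_add_one_eq_two]
    simpa [hu, hε₀, hn'] using this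
  subst hv
  have htop := hcoeff (n + 2)
  have hsub := hcoeff n
  simp only [C_0, add_zero, coeff_zero, sub_zero, comp_C_mul_X_coeff, ChebT,
    coeff_dickson_one_self, coeff_dickson_one_sub_two] at htop hsub
  have hpow : ε * u ^ (n + 1) = 1 := by
    rw [htop]
    field_simp
    ring
  have hζ : ζ * u ^ 2 = 1 := by
    have : ζ = u⁻¹ * (ε * u ^ n) := by
      apply mul_left_cancel₀ hn
      linear_combination -hsub
    rw [this, ← hpow]
    field_simp
    ring
  calc ζ ^ (n + 1) = ζ ^ (n + 1) * (ε * u ^ (n + 1)) ^ 2 := by rw [hpow]; ring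
    _ = (ζ * u ^ 2) ^ (n + 1) * ε ^ 2 := by ring
    _ = 1 := by rw [hζ, hε]; ring

/-- If `s^(d-1) = ε`, scaling by `s⁻¹` conjugates `D_d(x, s²)` to `ε T_d`. -/
theorem affConj_of_pow_eq {n : ℕ} {s ε : ℂ} (hs : s ≠ 0) (h : s ^ (n + 1) = ε) :
    AffConj (dickson 1 (s ^ 2) (n + 2)) (C ε * ChebT (n + 2)) := by
  refine ⟨s⁻¹, 0, inv_ne_zero hs, ?_⟩
  have hD := congrArg (fun p : ℂ[X] => p.comp (C s⁻¹ * X)) (dickson_comp_C_mul_X 1 s 1 (n + 2))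
  have hX : (C s * X : ℂ[X]).comp (C s⁻¹ * X) = X := by
    rw [mul_comp, C_comp, X_comp, ← mul_assoc, ← C_mul, mul_inv_cancel₀ hs, C_1, one_mul]
  simp only [comp_assoc, hX, comp_X, mul_one, mul_comp, C_comp] at hD
  rw [hD, ← h]
  simp only [ChebT, C_0, sub_zero, add_zero, mul_comp, C_comp, X_comp, inv_inv, C_pow, pow_comp]
  ring

/-- For `d ≥ 2` and `ζ ∈ ℂ`, the polynomial `D_d(x, ζ)` is affinely conjugate
to `T_d` or to `−T_d` if and only if `ζ^(d-1) = 1`. -/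
theorem stmt7 (d : ℕ) (hd : 2 ≤ d) (ζ : ℂ) :
    (AffConj (dickson 1 ζ d) (ChebT d) ∨ AffConj (dickson 1 ζ d) (-ChebT d)) ↔
      ζ ^ (d - 1) = 1 := by
  obtain ⟨n, rfl⟩ := Nat.exists_eq_add_of_le' hd
  have hone : ChebT (n + 2) = C 1 * ChebT (n + 2) := by simp
  have hneg : -ChebT (n + 2) = C (-1) * ChebT (n + 2) := by simp
  rw [hneg, show n + 2 - 1 = n + 1 from rfl]
  constructor
  · rintro (h | h)
    · rw [hone] at h
      exact pow_eq_one_of_affConj (by norm_num) h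
    · exact pow_eq_one_of_affConj (by norm_num) h
  · intro h
    obtain ⟨s, rfl⟩ := IsAlgClosed.exists_pow_nat_eq ζ two_pos
    have hs : s ≠ 0 := by
      rintro rfl
      simp at h
    rw [pow_right_comm, sq, mul_self_eq_one_iff] at h
    rcases h with h | h
    · left
      rw [hone]
      exact affConj_of_pow_eq hs h
    · exact Or.inr (affConj_of_pow_eq hs h)
end
end

section
/- Suppose a, b, c, d are non-constant polynomials over ℂ such that a ∘ b = c ∘ d and deg(a) = deg(c). Then there exists an affine map A(x) = ux + v with u ≠ 0 such that a = c ∘ A and b = A⁻¹ ∘ d. -/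
open Polynomial

/-- Two polynomials with the same degree and leading coefficient whose `n`-th powers agree up to
degree `(n - 1) * m` differ by a constant. -/
theorem natDegree_sub_eq_zero_of_natDegree_pow_sub_pow_le {R : Type*} [CommRing R] [IsDomain R]
    [CharZero R] {p q : R[X]} {m n : ℕ} (hn : 0 < n) (hp : p.natDegree ≤ m)
    (hq : q.natDegree ≤ m) (hcoeff : p.coeff m = q.coeff m) (hq0 : q.coeff m ≠ 0)
    (h : (p ^ n - q ^ n).natDegree ≤ (n - 1) * m) : (p - q).natDegree = 0 := by
  set S : R[X] := ∑ i ∈ Finset.range n, p ^ i * q ^ (n - 1 - i) with hS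
  have hScoeff : S.coeff ((n - 1) * m) = n * q.coeff m ^ (n - 1) := by
    have hterm : ∀ i ∈ Finset.range n,
        (p ^ i * q ^ (n - 1 - i)).coeff ((n - 1) * m) = q.coeff m ^ (n - 1) := by
      intro i hi
      have hi' : i + (n - 1 - i) = n - 1 := by
        have := Finset.mem_range.mp hi
        omega
      have hsplit : (n - 1) * m = i * m + (n - 1 - i) * m := by rw [← add_mul, hi']
      rw [hsplit, coeff_mul_add_eq_of_natDegree_le (natDegree_pow_le_of_le i hp)
        (natDegree_pow_le_of_le _ hq),
        coeff_pow_of_natDegree_le hp, coeff_pow_of_natDegree_le hq, hcoeff, ← pow_add, hi']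
    rw [hS, finsetSum_coeff, Finset.sum_congr rfl hterm]
    simp
  have hSne : S.coeff ((n - 1) * m) ≠ 0 := by
    rw [hScoeff]
    exact mul_ne_zero (Nat.cast_ne_zero.mpr hn.ne') (pow_ne_zero _ hq0)
  by_cases hpq : p - q = 0
  · simp [hpq]
  · have hSdeg := le_natDegree_of_ne_zero hSne
    have hS0 : S ≠ 0 := by
      intro h0
      simp [h0] at hSne
    rw [← geom_sum₂_mul p q n, ← hS, natDegree_mul hS0 hpq] at h
    omega

/-- Up to degree `(deg a - 1) * deg b`, the composition `a ∘ b` is its leading term in `b`. -/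
theorem natDegree_comp_sub_leadingCoeff_mul_pow_le {R : Type*} [CommRing R] (a b : R[X]) :
    (a.comp b - C a.leadingCoeff * b ^ a.natDegree).natDegree
      ≤ (a.natDegree - 1) * b.natDegree := by
  have h : a.comp b - C a.leadingCoeff * b ^ a.natDegree = a.eraseLead.comp b := by
    have h' := congrArg (fun p => p.comp b) (eraseLead_add_C_mul_X_pow a)
    simp only [add_comp, mul_comp, C_comp, pow_comp, X_comp] at h'
    rw [← h', add_sub_cancel_right]
  rw [h]
  exact natDegree_comp_le.trans (Nat.mul_le_mul_right _ (eraseLead_natDegree_le a))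

/-- Ritt/Zieve–Müller. If `a, b, c, e` are non-constant complex polynomials with
`a ∘ b = c ∘ e` and `deg a = deg c`, then there is an affine map `A(x) = ux + v`, `u ≠ 0`, with
`a = c ∘ A` and `b = A⁻¹ ∘ e`, where `A⁻¹(x) = (x − v)/u`. -/
theorem stmt8 (a b c e : Polynomial ℂ)
    (ha : 0 < a.natDegree) (hb : 0 < b.natDegree) (hc : 0 < c.natDegree) (he : 0 < e.natDegree)
    (hcomp : a.comp b = c.comp e) (hdeg : a.natDegree = c.natDegree) :
    ∃ u v : ℂ, u ≠ 0 ∧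
      a = c.comp (C u * X + C v) ∧
      b = (C u⁻¹ * (X - C v)).comp e := by
  have hm : b.natDegree = e.natDegree := by
    have h := congrArg natDegree hcomp
    rw [natDegree_comp, natDegree_comp, hdeg] at h
    exact Nat.eq_of_mul_eq_mul_left hc h
  have hb0 : b.leadingCoeff ≠ 0 := leadingCoeff_ne_zero.mpr (ne_zero_of_natDegree_gt hb)
  have he0 : e.leadingCoeff ≠ 0 := leadingCoeff_ne_zero.mpr (ne_zero_of_natDegree_gt he)
  have hc0 : c.leadingCoeff ≠ 0 := leadingCoeff_ne_zero.mpr (ne_zero_of_natDegree_gt hc)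
  obtain ⟨u, hu⟩ : ∃ u, u = e.leadingCoeff / b.leadingCoeff := ⟨_, rfl⟩
  have hu0 : u ≠ 0 := hu ▸ div_ne_zero he0 hb0
  have hub : u * b.leadingCoeff = e.leadingCoeff := by rw [hu, div_mul_cancel₀ _ hb0]
  have hlead : a.leadingCoeff = c.leadingCoeff * u ^ c.natDegree := by
    have h := congrArg leadingCoeff hcomp
    rw [leadingCoeff_comp hb.ne', leadingCoeff_comp he.ne', hdeg, ← hub, mul_pow,
      ← mul_assoc] at h
    exact mul_right_cancel₀ (pow_ne_zero _ hb0) h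
  have hpow : ((C u * b) ^ c.natDegree - e ^ c.natDegree).natDegree
      ≤ (c.natDegree - 1) * e.natDegree := by
    have h₁ := natDegree_comp_sub_leadingCoeff_mul_pow_le a b
    have h₂ := natDegree_comp_sub_leadingCoeff_mul_pow_le c e
    rw [hdeg, hm] at h₁
    have h := natDegree_sub_le_of_le h₂ h₁
    rw [max_self, hcomp, hlead] at h
    rw [← natDegree_C_mul hc0]
    refine (congrArg natDegree ?_).trans_le h
    simp only [C_mul, C_pow]
    ring
  have hconst : (C u * b - e).natDegree = 0 := by
    refine natDegree_sub_eq_zero_of_natDegree_pow_sub_pow_le hc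
      ((natDegree_C_mul hu0).trans hm).le le_rfl ?_ he0 hpow
    rw [coeff_C_mul, ← hm, coeff_natDegree, hub, hm, coeff_natDegree]
  obtain ⟨w, hw⟩ := natDegree_eq_zero.mp hconst
  have heq : e = (C u * X + C (-w)).comp b := by
    simp only [add_comp, mul_comp, C_comp, X_comp]
    rw [C_neg, hw]
    ring
  refine ⟨u, -w, hu0, ?_, ?_⟩
  · have hzero : (a - c.comp (C u * X + C (-w))).comp b = 0 := by
      rw [sub_comp, comp_assoc, ← heq, hcomp, sub_self]
    rcases comp_eq_zero_iff.mp hzero with h | ⟨-, h⟩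
    · exact sub_eq_zero.mp h
    · rw [h, natDegree_C] at hb
      exact absurd hb (lt_irrefl 0)
  · have hinv : C u⁻¹ * C u = (1 : ℂ[X]) := by rw [← C_mul, inv_mul_cancel₀ hu0, C_1]
    conv_rhs => rw [heq]
    simp only [add_comp, mul_comp, sub_comp, C_comp, X_comp, add_sub_cancel_right]
    rw [← mul_assoc, hinv, one_mul]
end

section
/- Let n ≥ 1 be an integer and let F_j, G_j (0 ≤ j ≤ n−1) be non-constant polynomials over ℂ such that F_{n−1} ∘ ⋯ ∘ F_0 = G_{n−1} ∘ ⋯ ∘ G_0 and deg F_j = deg G_j for all 0 ≤ j ≤ n−1. Then there exist affine maps A_1, …, A_{n−1} such that F_0 = A_1⁻¹ ∘ G_0, F_j = A_{j+1}⁻¹ ∘ G_j ∘ A_j for 1 ≤ j ≤ n−2, and F_{n−1} = G_{n−1} ∘ A_{n−1}. -/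
open Polynomial

noncomputable section

/-- `compChain f n = f_{n-1} ∘ ⋯ ∘ f_0` (and `compChain f 0 = X`, the identity). -/
def compChain (f : ℕ → Polynomial ℂ) : ℕ → Polynomial ℂ
  | 0 => X
  | k + 1 => (f k).comp (compChain f k)

/-- Precomposition with a non-constant polynomial is injective. -/
theorem comp_right_cancel_of_natDegree_pos {K : Type*} [Field K] {a b p : K[X]}
    (hp : 0 < p.natDegree) (h : a.comp p = b.comp p) : a = b := by
  have h0 : (a - b).comp p = 0 := by rw [sub_comp, h, sub_self]
  rcases comp_eq_zero_iff.mp h0 with h1 | ⟨-, h1⟩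
  · exact sub_eq_zero.mp h1
  · rw [h1, natDegree_C] at hp
    exact absurd hp (lt_irrefl 0)

/-- If `p` and `q` have the same degree and leading coefficient, and `p ^ m - q ^ m` has degree at
most `(m - 1) * deg p`, then `p - q` is constant. -/
theorem natDegree_sub_eq_zero_of_natDegree_pow_sub_pow_le_s9 {K : Type*} [Field K] [CharZero K]
    {p q : K[X]} {m : ℕ} (hp : 0 < p.natDegree) (hpq : p.natDegree = q.natDegree)
    (hlead : p.leadingCoeff = q.leadingCoeff)
    (h : (p ^ (m + 1) - q ^ (m + 1)).natDegree ≤ m * p.natDegree) : (p - q).natDegree = 0 := by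
  by_cases hr : p - q = 0
  · simp [hr]
  set d := p.natDegree with hd
  set S := ∑ i ∈ Finset.range (m + 1), p ^ i * q ^ (m + 1 - 1 - i) with hS
  have hlead0 : p.leadingCoeff ≠ 0 := by
    rw [Ne, leadingCoeff_eq_zero]
    rintro rfl
    simp [hd] at hp
  have hcoeff : S.coeff (m * d) = (m + 1 : K) * p.leadingCoeff ^ m := by
    rw [hS, finsetSum_coeff]
    have hterm : ∀ i ∈ Finset.range (m + 1),
        (p ^ i * q ^ (m + 1 - 1 - i)).coeff (m * d) = p.leadingCoeff ^ m := by
      intro i hi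
      obtain ⟨j, rfl⟩ := Nat.exists_eq_add_of_le (Nat.lt_succ_iff.mp (Finset.mem_range.mp hi))
      have hpow : i + j + 1 - 1 - i = j := by omega
      rw [hpow, add_mul, coeff_mul_add_eq_of_natDegree_le natDegree_pow_le
        (hpq ▸ natDegree_pow_le), coeff_pow_of_natDegree_le le_rfl,
        coeff_pow_of_natDegree_le hpq.ge, coeff_natDegree]
      rw [hpq, coeff_natDegree, ← hlead, pow_add]
    rw [Finset.sum_congr rfl hterm]
    simp
  have hcoeff0 : S.coeff (m * d) ≠ 0 := by
    rw [hcoeff]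
    exact mul_ne_zero (by exact_mod_cast Nat.succ_ne_zero m) (pow_ne_zero _ hlead0)
  have hS0 : S ≠ 0 := by
    intro h0
    simp [h0] at hcoeff0
  have hle := le_natDegree_of_ne_zero hcoeff0
  rw [← Commute.mul_geom_sum₂ (Commute.all p q) (m + 1), natDegree_mul hr hS0] at h
  omega

/-- If `a ∘ p = b ∘ q` where the leading coefficients of `p` and `q` agree and the degrees match,
then `p - q` is constant. -/
theorem natDegree_sub_eq_zero_of_comp_eq {K : Type*} [Field K] [CharZero K] {a b p q : K[X]}
    (ha : 0 < a.natDegree) (hab : a.natDegree = b.natDegree) (hp : 0 < p.natDegree)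
    (hpq : p.natDegree = q.natDegree) (hlead : p.leadingCoeff = q.leadingCoeff)
    (h : a.comp p = b.comp q) : (p - q).natDegree = 0 := by
  obtain ⟨m, hm⟩ := Nat.exists_eq_succ_of_ne_zero ha.ne'
  have hp0 : p.leadingCoeff ≠ 0 := leadingCoeff_ne_zero.mpr (ne_zero_of_natDegree_gt hp)
  have ha0 : a.leadingCoeff ≠ 0 := leadingCoeff_ne_zero.mpr (ne_zero_of_natDegree_gt ha)
  have hleadab : a.leadingCoeff = b.leadingCoeff := by
    have h' := congrArg leadingCoeff h
    rw [leadingCoeff_comp hp.ne', leadingCoeff_comp (hpq ▸ hp.ne'), ← hlead, ← hab] at h'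
    exact mul_right_cancel₀ (pow_ne_zero _ hp0) h'
  have hsplit : ∀ c r : K[X],
      c.comp r = c.eraseLead.comp r + C c.leadingCoeff * r ^ c.natDegree := by
    intro c r
    conv_lhs => rw [← eraseLead_add_C_mul_X_pow c]
    rw [add_comp, mul_comp, C_comp, X_pow_comp]
  have hdiff : C a.leadingCoeff * (p ^ (m + 1) - q ^ (m + 1)) =
      b.eraseLead.comp q - a.eraseLead.comp p := by
    rw [hsplit a p, hsplit b q, ← hab, ← hleadab, hm, Nat.succ_eq_add_one] at h
    linear_combination h
  have hcomp_le : ∀ c r : K[X], c.natDegree = m + 1 →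
      (c.eraseLead.comp r).natDegree ≤ m * r.natDegree := by
    intro c r hc
    refine natDegree_comp_le.trans (Nat.mul_le_mul_right _ ?_)
    have := eraseLead_natDegree_le c
    omega
  refine natDegree_sub_eq_zero_of_natDegree_pow_sub_pow_le_s9 (m := m) hp hpq hlead ?_
  rw [← natDegree_C_mul ha0, hdiff]
  refine (natDegree_sub_le _ _).trans (max_le ?_ (hcomp_le a p hm))
  rw [hpq]
  exact hcomp_le b q (hab ▸ hm)

/-- If `a ∘ p = b ∘ q` with `deg a = deg b` and `deg p = deg q`, then `p` and `q` differ by an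
affine map on the left. -/
theorem exists_affine_of_comp_eq {K : Type*} [Field K] [CharZero K] {a b p q : K[X]}
    (ha : 0 < a.natDegree) (hab : a.natDegree = b.natDegree) (hp : 0 < p.natDegree)
    (hpq : p.natDegree = q.natDegree) (h : a.comp p = b.comp q) :
    ∃ u v : K, u ≠ 0 ∧ p = C u * q + C v := by
  have hp0 : p.leadingCoeff ≠ 0 := leadingCoeff_ne_zero.mpr (ne_zero_of_natDegree_gt hp)
  have hq0 : q.leadingCoeff ≠ 0 := leadingCoeff_ne_zero.mpr (ne_zero_of_natDegree_gt (hpq ▸ hp))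
  set u := p.leadingCoeff / q.leadingCoeff with hu
  have hu0 : u ≠ 0 := div_ne_zero hp0 hq0
  have hscale : (b.comp (C u⁻¹ * X)).comp (C u * q) = b.comp q := by
    rw [comp_assoc]
    simp [← mul_assoc, ← C_mul, inv_mul_cancel₀ hu0]
  have hconst := natDegree_sub_eq_zero_of_comp_eq (b := b.comp (C u⁻¹ * X)) (q := C u * q) ha
    (by rw [natDegree_comp, natDegree_C_mul_X _ (inv_ne_zero hu0), mul_one, hab]) hp
    (by rw [natDegree_C_mul hu0, hpq])
    (by rw [leadingCoeff_mul, leadingCoeff_C, hu, div_mul_cancel₀ _ hq0]) (h.trans hscale.symm)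
  obtain ⟨v, hv⟩ := natDegree_eq_zero.mp hconst
  exact ⟨u, v, hu0, by rw [hv]; ring⟩

theorem natDegree_compChain (f : ℕ → ℂ[X]) (n : ℕ) :
    (compChain f n).natDegree = ∏ j ∈ Finset.range n, (f j).natDegree := by
  induction n with
  | zero => simp [compChain]
  | succ k ih => rw [compChain, natDegree_comp, ih, Finset.prod_range_succ, mul_comm]

theorem natDegree_compChain_pos {f : ℕ → ℂ[X]} {n : ℕ} (hf : ∀ j < n, 0 < (f j).natDegree) :
    0 < (compChain f n).natDegree := by
  rw [natDegree_compChain]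
  exact Finset.prod_pos fun j hj => hf j (Finset.mem_range.mp hj)

/-- The partial compositions of two chains with equal total composition and matching degrees agree
up to affine maps. -/
theorem exists_affine_compChain {n : ℕ} {F G : ℕ → ℂ[X]}
    (hG : ∀ j < n, 0 < (G j).natDegree)
    (hdeg : ∀ j < n, (F j).natDegree = (G j).natDegree)
    (hcomp : compChain F n = compChain G n) {k : ℕ} (hk : k ≤ n) :
    ∃ u v : ℂ, u ≠ 0 ∧ compChain G k = C u * compChain F k + C v := by
  induction hk using Nat.decreasingInduction with
  | self => exact ⟨1, 0, one_ne_zero, by simp [hcomp]⟩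
  | of_succ k hk ih =>
    obtain ⟨u, v, hu, h⟩ := ih
    refine exists_affine_of_comp_eq (a := G k) (b := C u * F k + C v) (hG k hk) ?_
      (natDegree_compChain_pos fun j hj => hG j (hj.trans hk)) ?_ ?_
    · rw [natDegree_add_C, natDegree_C_mul hu, hdeg k hk]
    · rw [natDegree_compChain, natDegree_compChain]
      exact Finset.prod_congr rfl fun j hj =>
        (hdeg j ((Finset.mem_range.mp hj).trans hk)).symm
    · simpa [compChain] using h

/-- An affine map fixing a non-constant polynomial is the identity. -/
theorem affine_eq_id_of_natDegree_pos {K : Type*} [Field K] {p : K[X]} {u v : K}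
    (hp : 0 < p.natDegree) (h : p = C u * p + C v) : u = 1 ∧ v = 0 := by
  have hX : (X : K[X]) = C u * X + C v :=
    comp_right_cancel_of_natDegree_pos hp (by simpa using h)
  have h0 := congrArg (coeff · 0) hX
  have h1 := congrArg (coeff · 1) hX
  simp [coeff_C] at h0 h1
  exact ⟨h1.symm, h0.symm⟩

/-- If `F_{n−1} ∘ ⋯ ∘ F_0 = G_{n−1} ∘ ⋯ ∘ G_0` with all `F_j, G_j` non-constant and
`deg F_j = deg G_j`, then there are affine maps `A_1, …, A_{n−1}` (encoded by `A_j(x) = u j * x + v j`,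
with the boundary convention `A_0 = A_n = id`, i.e. `u 0 = u n = 1`, `v 0 = v n = 0`) such that
`F_j = A_{j+1}⁻¹ ∘ G_j ∘ A_j` for all `0 ≤ j ≤ n−1`; this comprises exactly
`F_0 = A_1⁻¹ ∘ G_0`, `F_j = A_{j+1}⁻¹ ∘ G_j ∘ A_j` for `1 ≤ j ≤ n−2`, and
`F_{n−1} = G_{n−1} ∘ A_{n−1}`. -/
theorem stmt9 (n : ℕ) (hn : 1 ≤ n) (F G : ℕ → Polynomial ℂ)
    (hF : ∀ j < n, 0 < (F j).natDegree) (hG : ∀ j < n, 0 < (G j).natDegree)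
    (hdeg : ∀ j < n, (F j).natDegree = (G j).natDegree)
    (hcomp : compChain F n = compChain G n) :
    ∃ u v : ℕ → ℂ, u 0 = 1 ∧ v 0 = 0 ∧ u n = 1 ∧ v n = 0 ∧ (∀ j ≤ n, u j ≠ 0) ∧
      ∀ j < n,
        F j = (C (u (j + 1))⁻¹ * (X - C (v (j + 1)))).comp
          ((G j).comp (C (u j) * X + C (v j))) := by
  have hex : ∀ k, ∃ u v : ℂ, k ≤ n → u ≠ 0 ∧ compChain G k = C u * compChain F k + C v := by
    intro k
    by_cases hk : k ≤ n
    · obtain ⟨u, v, h⟩ := exists_affine_compChain hG hdeg hcomp hk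
      exact ⟨u, v, fun _ => h⟩
    · exact ⟨0, 0, fun h => absurd h hk⟩
  choose u v huv using hex
  obtain ⟨hu0, hv0⟩ := affine_eq_id_of_natDegree_pos (p := (X : ℂ[X])) (by simp)
    (huv 0 n.zero_le).2
  obtain ⟨hun, hvn⟩ := affine_eq_id_of_natDegree_pos (natDegree_compChain_pos hF)
    (hcomp.trans (huv n le_rfl).2)
  refine ⟨u, v, hu0, hv0, hun, hvn, fun j hj => (huv j hj).1, fun j hj => ?_⟩
  refine comp_right_cancel_of_natDegree_pos (p := compChain F j)
    (natDegree_compChain_pos fun i hi => hF i (hi.trans hj)) ?_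
  obtain ⟨hu, h⟩ := huv (j + 1) hj
  have haff : (C (u j) * X + C (v j)).comp (compChain F j) = compChain G j := by
    simpa using (huv j hj.le).2.symm
  rw [comp_assoc, comp_assoc, haff]
  change compChain F (j + 1) = (C (u (j + 1))⁻¹ * (X - C (v (j + 1)))).comp (compChain G (j + 1))
  rw [h]
  simp [← mul_assoc, ← C_mul, inv_mul_cancel₀ hu]
end
end

section
/- Let d ≥ 2 and n ≥ 1 be integers and let f_0, …, f_{n−1} be monic polynomials over ℂ of degree d. If the composition f_{n−1} ∘ ⋯ ∘ f_0 is affinely conjugate to z^{dⁿ}, then there exist complex numbers c_0, …, c_{n−1} (with indices taken modulo n, so c_n = c_0) such that f_j(x) = (x − c_j)^d + c_{j+1} for all 0 ≤ j ≤ n−1. -/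
open Polynomial

noncomputable section

/-- If a composition `g ∘ h` with `h` monic is a translate of a power of `X - a`, then both factors
are translates of powers of linear polynomials. -/
theorem eq_pow_add_of_comp_eq_pow_add {g h : ℂ[X]} {a b : ℂ} {d M : ℕ} (hd : 0 < d) (hM : 0 < M)
    (hg : g.natDegree = d) (hh : h.Monic) (hhd : h.natDegree = M)
    (hgh : g.comp h = (X - C a) ^ (M * d) + C b) :
    h = (X - C a) ^ M + C (h.eval a) ∧ g = (X - C (h.eval a)) ^ d + C b := by
  have hcomp : (g - C b).comp h = (X - C a) ^ (M * d) := by simp [hgh]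
  obtain ⟨r, hr⟩ : ∃ r, (g - C b).IsRoot r := by
    apply IsAlgClosed.exists_root
    apply ne_of_gt
    rw [← natDegree_pos_iff_degree_pos, natDegree_sub_C, hg]
    exact hd
  have hdvd : h - C r ∣ (X - C a) ^ (M * d) := by
    obtain ⟨q, hq⟩ := dvd_iff_isRoot.mpr hr
    exact ⟨q.comp h, by rw [← hcomp, hq]; simp⟩
  have hmon : (h - C r).Monic :=
    hh.sub_of_left (lt_of_le_of_lt degree_C_le (natDegree_pos_iff_degree_pos.mp (hhd ▸ hM)))
  obtain ⟨i, -, hi⟩ := (dvd_prime_pow (prime_X_sub_C a) _).mp hdvd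
  have hi' : h - C r = (X - C a) ^ i :=
    eq_of_monic_of_associated hmon ((monic_X_sub_C a).pow i) hi
  have hiM : i = M := by
    have := congrArg natDegree hi'
    rw [natDegree_sub_C, hhd, natDegree_pow, natDegree_X_sub_C, mul_one] at this
    exact this.symm
  subst hiM
  have hh_eq : h = (X - C a) ^ i + C r := by rw [← hi']; ring
  have hra : h.eval a = r := by rw [hh_eq]; simp [hM.ne']
  rw [hra]
  refine ⟨hh_eq, ?_⟩
  have hzero : (g - C b - (X - C r) ^ d).comp h = 0 := by
    rw [sub_comp, hcomp, pow_comp, sub_comp, X_comp, C_comp, hi', pow_mul, sub_self]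
  rcases comp_eq_zero_iff.mp hzero with h0 | ⟨-, h0⟩
  · linear_combination h0
  · rw [h0, natDegree_C] at hhd
    omega

theorem compChain_monic_natDegree {d n : ℕ} (hd : 0 < d) {f : ℕ → ℂ[X]}
    (hmonic : ∀ j < n, (f j).Monic) (hdeg : ∀ j < n, (f j).natDegree = d) :
    ∀ k ≤ n, (compChain f k).Monic ∧ (compChain f k).natDegree = d ^ k := by
  intro k
  induction k with
  | zero => intro _; simp [compChain, monic_X]
  | succ k ih =>
    intro hk
    obtain ⟨h1, h2⟩ := ih (by omega)
    refine ⟨(hmonic k hk).comp h1 (by rw [h2]; positivity), ?_⟩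
    rw [compChain, natDegree_comp, h2, hdeg k hk, pow_succ']

/-- A monic polynomial affinely conjugate to `X ^ N` is `(X - a) ^ N + a` for some `a`. -/
theorem AffConj.exists_eq_of_monic {F : ℂ[X]} {N : ℕ} (hN : 0 < N) (hF : F.Monic)
    (h : AffConj F (X ^ N)) : ∃ a : ℂ, F = (X - C a) ^ N + C a := by
  obtain ⟨u, v, hu, h⟩ := h
  set a : ℂ := -(u⁻¹ * v) with ha
  have hlin : C u * X + C v = C u * (X - C a) := by
    rw [mul_sub, ← C_mul, ha, mul_neg, mul_inv_cancel_left₀ hu, C_neg, sub_neg_eq_add]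
  have hexp : F = C (u⁻¹ * u ^ N) * (X - C a) ^ N + C a := by
    rw [h, pow_comp, X_comp, hlin, mul_comp, sub_comp, X_comp, C_comp, C_comp, mul_pow, ha]
    simp only [C_neg, C_mul, C_pow]
    ring
  have hpow : ((X - C a) ^ N).Monic := (monic_X_sub_C a).pow N
  have hlead : u⁻¹ * u ^ N = 1 := by
    have hne : u⁻¹ * u ^ N ≠ 0 := mul_ne_zero (inv_ne_zero hu) (pow_ne_zero N hu)
    have hl := hF.leadingCoeff
    rw [hexp, leadingCoeff_add_of_degree_lt', leadingCoeff_mul, leadingCoeff_C,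
      hpow.leadingCoeff, mul_one] at hl
    · exact hl
    · refine lt_of_le_of_lt degree_C_le ?_
      rw [degree_C_mul hne, ← natDegree_pos_iff_degree_pos, natDegree_pow, natDegree_X_sub_C,
        mul_one]
      exact hN
  exact ⟨a, by rw [hexp, hlead, C_1, one_mul]⟩

/-- If `f_0, …, f_{n−1}` are monic of degree `d ≥ 2` and `f_{n−1} ∘ ⋯ ∘ f_0` is
affinely conjugate to `z^(dⁿ)`, then there are `c_0, …, c_{n−1} ∈ ℂ` (indices modulo `n`, so
`c_n = c_0`) with `f_j(x) = (x − c_j)^d + c_{j+1}` for all `0 ≤ j ≤ n−1`. -/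
theorem stmt10 (d n : ℕ) (hd : 2 ≤ d) (hn : 1 ≤ n) (f : ℕ → Polynomial ℂ)
    (hmonic : ∀ j < n, (f j).Monic) (hdeg : ∀ j < n, (f j).natDegree = d)
    (hconj : AffConj (compChain f n) (X ^ d ^ n)) :
    ∃ c : ℕ → ℂ, ∀ j < n, f j = (X - C (c j)) ^ d + C (c ((j + 1) % n)) := by
  have hd0 : 0 < d := by omega
  have hchain := compChain_monic_natDegree hd0 hmonic hdeg
  obtain ⟨a, ha⟩ := hconj.exists_eq_of_monic (by positivity) (hchain n le_rfl).1
  have hstep : ∀ k < n, ∀ b, compChain f (k + 1) = (X - C a) ^ d ^ (k + 1) + C b →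
      compChain f k = (X - C a) ^ d ^ k + C ((compChain f k).eval a) ∧
        f k = (X - C ((compChain f k).eval a)) ^ d + C b := fun k hk b hb =>
    eq_pow_add_of_comp_eq_pow_add hd0 (by positivity) (hdeg k hk) (hchain k hk.le).1
      (hchain k hk.le).2 (by rw [← pow_succ]; exact hb)
  have hn_eval : (compChain f n).eval a = a := by rw [ha]; simp [hd0.ne']
  have hall : ∀ k ≤ n, compChain f k = (X - C a) ^ d ^ k + C ((compChain f k).eval a) := by
    intro k hk
    induction hk using Nat.decreasingInduction with
    | self => rw [hn_eval]; exact ha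
    | of_succ k hk ih => exact (hstep k hk _ ih).1
  refine ⟨fun k => (compChain f k).eval a, fun j hj => ?_⟩
  have hmod : (compChain f ((j + 1) % n)).eval a = (compChain f (j + 1)).eval a := by
    rcases Nat.lt_or_ge (j + 1) n with h | h
    · rw [Nat.mod_eq_of_lt h]
    · obtain rfl : j + 1 = n := by omega
      rw [Nat.mod_self, hn_eval]
      simp [compChain]
  simp only [hmod]
  exact (hstep j hj _ (hall (j + 1) hj)).2
end
end

section
/- Let d ≥ 2 be an integer, let σ ∈ {1, −1}, and let φ ∈ ℂ[z] be a polynomial satisfying the functional equation φ(σ T_d(z)) = φ(z)^d for all z ∈ ℂ. Then φ is constant, and its constant value ζ satisfies ζ = ζ^d (so either ζ = 0 or ζ^{d−1} = 1). -/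
open Polynomial

noncomputable section

theorem exists_eq_add_inv (w : ℂ) : ∃ u : ℂ, u ≠ 0 ∧ w = u + u⁻¹ := by
  obtain ⟨s, hs⟩ := IsAlgClosed.exists_pow_nat_eq (w ^ 2 - 4) (n := 2) (by norm_num)
  have hprod : (w + s) / 2 * ((w - s) / 2) = 1 := by linear_combination (-1 / 4) * hs
  refine ⟨(w + s) / 2, left_ne_zero_of_mul_eq_one hprod, ?_⟩
  rw [inv_eq_of_mul_eq_one_right hprod]
  ring

theorem ChebT_eval_add_inv (d : ℕ) {v : ℂ} (hv : v ≠ 0) :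
    (ChebT d).eval (v + v⁻¹) = v ^ d + (v ^ d)⁻¹ := by
  rw [ChebT, dickson_one_one_eval_add_inv v v⁻¹ (mul_inv_cancel₀ hv), inv_pow]

theorem ChebT_eval_surjective {d : ℕ} (hd : d ≠ 0) :
    Function.Surjective fun z : ℂ => (ChebT d).eval z := by
  intro w
  obtain ⟨u, hu, rfl⟩ := exists_eq_add_inv w
  obtain ⟨v, rfl⟩ := IsAlgClosed.exists_pow_nat_eq u (Nat.pos_of_ne_zero hd)
  exact ⟨v + v⁻¹, ChebT_eval_add_inv d (ne_zero_pow hd hu)⟩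

/-- A surjective map is injective on the preimage of a finite set containing its own preimage. -/
theorem Function.Surjective.eq_of_apply_eq_of_preimage_subset {α : Type*} {f : α → α}
    (hf : Function.Surjective f) {S : Set α} (hS : S.Finite) (hpre : f ⁻¹' S ⊆ S)
    {x y : α} (hx : f x ∈ S) (hxy : f x = f y) : x = y := by
  obtain ⟨g, hg⟩ := hf.hasRightInverse
  have hmaps : Set.MapsTo g S S := fun s hs => hpre (by rwa [Set.mem_preimage, hg s])
  have hsurj : Set.SurjOn g S S :=
    ((hS.injOn_iff_bijOn_of_mapsTo hmaps).1 hg.injective.injOn).surjOn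
  have key : ∀ z, f z ∈ S → g (f z) = z := by
    intro z hz
    obtain ⟨s, -, rfl⟩ := hsurj (hpre hz)
    rw [hg s]
  rw [← key x hx, hxy, key y (hxy ▸ hx)]

/-- A point alone in its fibre under `T_d`, `d ≥ 2`, can only be `0`, and then `d = 2`. -/
theorem eq_two_and_eq_zero_of_ChebT_fiber {d : ℕ} (hd : 2 ≤ d) {z : ℂ}
    (hz : ∀ y, (ChebT d).eval z = (ChebT d).eval y → z = y) : d = 2 ∧ z = 0 := by
  obtain ⟨v, hv, rfl⟩ := exists_eq_add_inv z
  have hω := Complex.isPrimitiveRoot_exp d (by lia)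
  set ω := Complex.exp (2 * Real.pi * Complex.I / d)
  have hω0 : ω ≠ 0 := hω.ne_zero (by lia)
  have hω1 : ω ≠ 1 := hω.ne_one (by lia)
  have fib : ∀ η : ℂ, η ^ d = 1 → η ≠ 1 → η ≠ 0 → v ^ 2 * η = 1 := by
    intro η hη hη1 hη0
    have := hz (v * η + (v * η)⁻¹) (by
      rw [ChebT_eval_add_inv d hv, ChebT_eval_add_inv d (mul_ne_zero hv hη0), mul_pow, hη,
        mul_one])
    field_simp at this
    have h0 : (η - 1) * (v ^ 2 * η - 1) = 0 := by linear_combination -this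
    exact sub_eq_zero.1 ((mul_eq_zero.1 h0).resolve_left (sub_ne_zero.2 hη1))
  have h1 := fib ω hω.pow_eq_one hω1 hω0
  have h2 := fib ω⁻¹ (by rw [inv_pow, hω.pow_eq_one, inv_one]) (inv_ne_one.2 hω1)
    (inv_ne_zero hω0)
  have hv2 : v ^ 2 = ω := by field_simp at h2; exact h2
  have hsq : ω ^ 2 = 1 := by rw [← h1, hv2, sq]
  have hneg : ω = -1 := (sq_eq_sq_iff_eq_or_eq_neg.1 (by rw [hsq, one_pow])).resolve_left hω1
  refine ⟨le_antisymm (Nat.le_of_dvd two_pos (hω.dvd_of_pow_eq_one 2 hsq)) hd, ?_⟩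
  field_simp
  rw [hv2, hneg]
  ring

/-- If `d ≥ 2`, `σ ∈ {1, −1}`, and `φ ∈ ℂ[z]` satisfies `φ(σ T_d(z)) = φ(z)^d`
for all `z ∈ ℂ`, then `φ` is a constant `ζ` with `ζ = ζ^d` (so `ζ = 0` or `ζ^(d−1) = 1`). -/
theorem stmt15 (d : ℕ) (hd : 2 ≤ d) (σ : ℂ) (hσ : σ = 1 ∨ σ = -1) (φ : Polynomial ℂ)
    (h : ∀ z : ℂ, φ.eval (σ * (ChebT d).eval z) = φ.eval z ^ d) :
    ∃ ζ : ℂ, φ = C ζ ∧ ζ = ζ ^ d ∧ (ζ = 0 ∨ ζ ^ (d - 1) = 1) := by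
  have hσ2 : σ * σ = 1 := by rcases hσ with rfl | rfl <;> norm_num
  have hσ0 : σ ≠ 0 := left_ne_zero_of_mul_eq_one hσ2
  have hdeg : φ.degree ≤ 0 := by
    by_contra hpos
    rw [not_le] at hpos
    have hφ : φ ≠ 0 := ne_zero_of_degree_gt hpos
    have hfin : {z | φ.eval z = 0}.Finite := by
      simpa [IsRoot] using finite_setOfPred_isRoot hφ
    have hsurj : Function.Surjective fun z => σ * (ChebT d).eval z := fun w => by
      obtain ⟨z, hz⟩ := ChebT_eval_surjective (d := d) (by lia) (σ * w)
      exact ⟨z, by simp only at hz ⊢; rw [hz, ← mul_assoc, hσ2, one_mul]⟩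
    have hpre : (fun z => σ * (ChebT d).eval z) ⁻¹' {z | φ.eval z = 0} ⊆
        {z | φ.eval z = 0} := fun z hz =>
      eq_zero_of_pow_eq_zero (n := d) ((h z).symm.trans hz)
    have hroot : ∀ z, φ.eval z = 0 → d = 2 ∧ z = 0 := fun z hz =>
      eq_two_and_eq_zero_of_ChebT_fiber hd fun y hy =>
        hsurj.eq_of_apply_eq_of_preimage_subset hfin hpre
          ((h z).trans (by rw [hz, zero_pow (by lia)])) (congrArg (σ * ·) hy)
    obtain ⟨z, hz⟩ := Complex.exists_root hpos
    obtain ⟨rfl, rfl⟩ := hroot z hz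
    obtain ⟨y, hy⟩ := hsurj 0
    obtain ⟨-, rfl⟩ := hroot y (hpre ((congrArg (φ.eval ·) hy).trans hz))
    simp [ChebT, hσ0] at hy
    norm_num at hy
  rw [eq_C_of_degree_le_zero hdeg] at h ⊢
  have hζ : φ.coeff 0 = φ.coeff 0 ^ d := by simpa using h 0
  refine ⟨_, rfl, hζ, or_iff_not_imp_left.2 fun hne => mul_left_cancel₀ hne ?_⟩
  rw [← pow_succ', Nat.sub_add_cancel (by lia), ← hζ, mul_one]
end
end

section
/- Let d ≥ 2 be an integer and let u ∈ ℂ[t, t⁻¹] be a nonzero Laurent polynomial satisfying u(t^d) = u(t)^d for all t ∈ ℂ∖{0}. Then there exist η ∈ ℂ∖{0} and m ∈ ℤ such that u(t) = η t^m. -/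
open Polynomial in
/-- Over a domain of characteristic zero, a polynomial with nonzero constant term satisfying
`P(X ^ d) = P(X) ^ d` for some `d ≥ 2` is constant. -/
theorem Polynomial.eq_C_of_expand_eq_pow {R : Type*} [CommRing R] [IsDomain R] [CharZero R]
    {d : ℕ} (hd : 2 ≤ d) {P : R[X]} (hP0 : P.coeff 0 ≠ 0) (hP : expand R d P = P ^ d) :
    P = C (P.coeff 0) := by
  apply eq_C_of_derivative_eq_zero
  by_contra hP'
  obtain ⟨Q, hQ, hQ0⟩ := exists_eq_pow_rootMultiplicity_mul_and_not_dvd (derivative P) hP' 0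
  set n := (derivative P).rootMultiplicity 0
  rw [C_0, sub_zero] at hQ hQ0
  rw [X_dvd_iff] at hQ0
  have hder := congrArg derivative hP
  rw [derivative_expand, derivative_pow, hQ, map_mul, map_pow, expand_X] at hder
  have hd0 : (d : R[X]) ≠ 0 := by exact_mod_cast (by lia : d ≠ 0)
  obtain ⟨e, rfl⟩ : ∃ e, d = e + 2 := ⟨d - 2, by lia⟩
  have hcancel : X * (X ^ (e + (e + 1) * n) * expand R (e + 2) Q) = P ^ (e + 1) * Q := by
    apply mul_left_cancel₀ (mul_ne_zero hd0 (pow_ne_zero n X_ne_zero))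
    simp only [C_eq_natCast, show e + 2 - 1 = e + 1 by lia] at hder
    linear_combination hder
  have heval := congrArg (eval 0) hcancel
  rw [coeff_zero_eq_eval_zero] at hP0 hQ0
  rw [eval_mul, eval_X, zero_mul, eval_mul, eval_pow] at heval
  exact mul_ne_zero (pow_ne_zero _ hP0) hQ0 heval.symm

open Polynomial in
/-- A nonzero finitely supported coefficient family on `ℤ` is, up to a shift of the exponents by
its lowest exponent, that of a polynomial with nonzero constant term. -/
theorem Finsupp.exists_polynomial_eval_eq_sum_zpow {K : Type*} [Field K] {u : ℤ →₀ K}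
    (hu : u ≠ 0) :
    ∃ (m : ℤ) (P : K[X]), P.coeff 0 ≠ 0 ∧ (∀ k, u k = if m ≤ k then P.coeff (k - m).toNat else 0) ∧
      ∀ t : K, t ≠ 0 → (u.sum fun k a => a * t ^ k) = t ^ m * P.eval t := by
  have hne := Finsupp.support_nonempty_iff.2 hu
  set m := u.support.min' hne
  have hle : ∀ k ∈ u.support, m ≤ k := fun k hk => u.support.min'_le k hk
  have hcoeff : ∀ n : ℕ, (u.sum fun k a => monomial (k - m).toNat a).coeff n = u (m + n) := by
    intro n
    rw [Finsupp.sum, finsetSum_coeff, Finset.sum_eq_single (m + n)]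
    · simp
    · intro k hk hkn
      have := hle k hk
      exact coeff_monomial_of_ne _ (by lia)
    · intro hk
      simp [Finsupp.notMem_support_iff.1 hk]
  refine ⟨m, u.sum fun k a => monomial (k - m).toNat a, ?_, fun k => ?_, fun t ht => ?_⟩
  · rw [hcoeff]
    simpa using Finsupp.mem_support_iff.1 (u.support.min'_mem hne)
  · split_ifs with hk
    · rw [hcoeff]
      congr 1
      lia
    · by_contra hk'
      exact hk (hle k (Finsupp.mem_support_iff.2 hk'))
  · simp only [Finsupp.sum, eval_finsetSum, eval_monomial, Finset.mul_sum]
    refine Finset.sum_congr rfl fun k hk => ?_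
    have := hle k hk
    rw [mul_left_comm, ← zpow_natCast, ← zpow_add₀ ht]
    congr 2
    lia

/-- A Laurent polynomial `u ∈ ℂ[t, t⁻¹]` is encoded by its finitely supported
coefficient family `u : ℤ →₀ ℂ`, defining the function `t ↦ ∑ₖ uₖ tᵏ` on `ℂ∖{0}` (integer powers
are `zpow`). If `u ≠ 0` and `u(t^d) = u(t)^d` for all `t ≠ 0`, where `d ≥ 2`, then `u = η t^m`
for some `η ≠ 0` and `m ∈ ℤ`, i.e. the coefficient family is `Finsupp.single m η`. -/
theorem stmt16 (d : ℕ) (hd : 2 ≤ d) (u : ℤ →₀ ℂ) (hu : u ≠ 0)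
    (h : ∀ t : ℂ, t ≠ 0 →
      (u.sum fun k a => a * (t ^ d) ^ k) = (u.sum fun k a => a * t ^ k) ^ d) :
    ∃ η : ℂ, η ≠ 0 ∧ ∃ m : ℤ, u = Finsupp.single m η := by
  obtain ⟨m, P, hP0, hcoeff, heval⟩ := Finsupp.exists_polynomial_eval_eq_sum_zpow hu
  have hP : Polynomial.expand ℂ d P = P ^ d := by
    refine Polynomial.eq_of_infinite_eval_eq _ _ (Set.Infinite.mono (s := {0}ᶜ) ?_ ?_)
    · intro t ht
      have ht' : t ≠ 0 := ht
      have hdt := h t ht'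
      rw [heval _ (pow_ne_zero d ht'), heval t ht', mul_pow, ← zpow_natCast, ← zpow_natCast (t ^ m),
        ← zpow_mul, ← zpow_mul, mul_comm m] at hdt
      simpa [Polynomial.expand_eval] using mul_left_cancel₀ (zpow_ne_zero _ ht') hdt
    · exact (Set.finite_singleton 0).infinite_compl
  refine ⟨P.coeff 0, hP0, m, Finsupp.ext fun k => ?_⟩
  rw [hcoeff, Polynomial.eq_C_of_expand_eq_pow hd hP0 hP, Polynomial.coeff_C,
    Polynomial.coeff_C_zero, Finsupp.single_apply]
  split_ifs <;> first | rfl | lia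
end

section
/- Let d ≥ 2 be an integer, let ζ ∈ ℂ with ζ^{d−1} = 1, and let m ∈ {1, 2}. Define Π_m(u,v) = (u², u^m v), f_{2,m}(z,w) = (z^d, D_d(w, ζ z^m)), and g(u,v) = (u^d, D_d(v, ζ)). Then f_{2,m} ∘ Π_m = Π_m ∘ g as maps ℂ² → ℂ². -/
open Polynomial

/-- Dickson polynomials are weighted homogeneous: `D_n(c x, a c²) = cⁿ D_n(x, a)`. -/
theorem dickson_eval_mul {R : Type*} [CommRing R] (k : ℕ) (a c x : R) :
    ∀ n : ℕ, (dickson k (a * c ^ 2) n).eval (c * x) = c ^ n * (dickson k a n).eval x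
  | 0 => by simp [dickson_zero]
  | 1 => by simp [dickson_one]
  | n + 2 => by
    simp only [dickson_add_two, eval_sub, eval_mul, eval_X, eval_C,
      dickson_eval_mul k a c x n, dickson_eval_mul k a c x (n + 1)]
    ring

/-- For `d ≥ 2`, `ζ^(d−1) = 1`, `m ∈ {1,2}`, with `Π_m(u,v) = (u², uᵐ v)`,
`f_{2,m}(z,w) = (z^d, D_d(w, ζ zᵐ))` and `g(u,v) = (u^d, D_d(v, ζ))`, one has
`f_{2,m} ∘ Π_m = Π_m ∘ g` as maps `ℂ² → ℂ²`. -/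
theorem stmt17 (d : ℕ) (hd : 2 ≤ d) (ζ : ℂ) (hζ : ζ ^ (d - 1) = 1) (m : ℕ)
    (hm : m = 1 ∨ m = 2) :
    ∀ u v : ℂ,
      (fun zw : ℂ × ℂ => (zw.1 ^ d, (dickson 1 (ζ * zw.1 ^ m) d).eval zw.2))
          ((fun uv : ℂ × ℂ => (uv.1 ^ 2, uv.1 ^ m * uv.2)) (u, v))
        = (fun uv : ℂ × ℂ => (uv.1 ^ 2, uv.1 ^ m * uv.2))
          ((fun uv : ℂ × ℂ => (uv.1 ^ d, (dickson 1 ζ d).eval uv.2)) (u, v)) := by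
  intro u v
  have h := dickson_eval_mul 1 ζ (u ^ m) v d
  rw [pow_right_comm u m 2] at h
  simp only [h, pow_right_comm u 2 d, pow_right_comm u m d]
end
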